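/- arXiv:2001.11354 — 2 statements merged into one kernel-verified Lean document; each statement's English description precedes it below -/
import Mathlib

section
/- Let 𝒟=(D₁,D₂,D₃) be a positively oriented tangential disk triple, set α:=curv(D₁), β:=curv(D₂), γ:=curv(D₃) and κ:=√(βγ+γα+αβ), and let D_cir(𝒟) be the circumscribed disk of T(𝒟), i.e., the unique open disk in ℂ whose boundary circle contains the three points q₁(𝒟), q₂(𝒟), q₃(𝒟). Then the circle ∂D_cir(𝒟) is orthogonal to ∂D_j for every j∈{1,2,3}, the set closure(T(𝒟))∖{q₁(𝒟),q₂(𝒟),q₃(𝒟)} is contained in D_cir(𝒟), and curv(D_cir(𝒟))=κ. -/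
open MeasureTheory Filter Topology Matrix
open scoped ENNReal NNReal BigOperators

noncomputable section

/-- `D` is an open (round) disk in `ℂ`. -/
def IsOpenDisk (D : Set ℂ) : Prop := ∃ z : ℂ, ∃ r : ℝ, 0 < r ∧ D = Metric.ball z r

/-- `D` is an open half-plane in `ℂ`. -/
def IsOpenHalfPlane (D : Set ℂ) : Prop :=
  ∃ a : ℂ, a ≠ 0 ∧ ∃ c : ℝ, D = {z : ℂ | (a * z).re < c}

/-- The center of an open disk (junk value otherwise). -/
noncomputable def diskCenter (D : Set ℂ) : ℂ :=
  Classical.epsilon fun z : ℂ => ∃ r : ℝ, 0 < r ∧ D = Metric.ball z r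

/-- The radius of an open disk (junk value otherwise). -/
noncomputable def diskRadius (D : Set ℂ) : ℝ :=
  Classical.epsilon fun r : ℝ => 0 < r ∧ ∃ z : ℂ, D = Metric.ball z r

/-- The curvature of `D`: the reciprocal of the radius for an open disk,
and `0` for a half-plane (or anything that is not an open disk). -/
noncomputable def curv (D : Set ℂ) : ℝ :=
  haveI := Classical.propDecidable (IsOpenDisk D)
  if IsOpenDisk D then (diskRadius D)⁻¹ else 0

/-- A tangential disk triple: each member is an open disk or an open half-plane
(at most one half-plane), and the closures of distinct members meet in exactly one point. -/
def IsTDT (𝒟 : Fin 3 → Set ℂ) : Prop :=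
  ((∀ j, IsOpenDisk (𝒟 j)) ∨
    (∃ j, IsOpenHalfPlane (𝒟 j) ∧ ∀ k, k ≠ j → IsOpenDisk (𝒟 k))) ∧
  ∀ j k, j ≠ k → ∃ p : ℂ, closure (𝒟 j) ∩ closure (𝒟 k) = {p}

/-- The ideal triangle `T(𝒟)`: the unique bounded connected component of
`ℂ ∖ (closure D₁ ∪ closure D₂ ∪ closure D₃)`. -/
noncomputable def idealTriangle (𝒟 : Fin 3 → Set ℂ) : Set ℂ :=
  Classical.epsilon fun T : Set ℂ =>
    Bornology.IsBounded T ∧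
    ∃ z ∈ (⋃ j, closure (𝒟 j))ᶜ, T = connectedComponentIn (⋃ j, closure (𝒟 j))ᶜ z

/-- `q_j(𝒟)`: the tangency point of the two members other than the `j`-th one. -/
noncomputable def tangencyPoint (𝒟 : Fin 3 → Set ℂ) (j : Fin 3) : ℂ :=
  Classical.epsilon fun p : ℂ => closure (𝒟 (j + 1)) ∩ closure (𝒟 (j + 2)) = {p}

/-- `𝒟` is a positively oriented tangential disk triple: the tangency points
`q₁(𝒟), q₂(𝒟), q₃(𝒟)` occur in counterclockwise order, i.e. the ideal triangle
lies to the left of its boundary oriented through `q₁(𝒟), q₂(𝒟), q₃(𝒟)` in this order. -/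
def IsTDTplus (𝒟 : Fin 3 → Set ℂ) : Prop :=
  IsTDT 𝒟 ∧
  0 < ((tangencyPoint 𝒟 1 - tangencyPoint 𝒟 0).re *
        (tangencyPoint 𝒟 2 - tangencyPoint 𝒟 0).im -
       (tangencyPoint 𝒟 1 - tangencyPoint 𝒟 0).im *
        (tangencyPoint 𝒟 2 - tangencyPoint 𝒟 0).re)

/-- `D` is an inscribed disk of the ideal triangle of `𝒟`. -/
def IsInscribedDisk (𝒟 : Fin 3 → Set ℂ) (D : Set ℂ) : Prop :=
  IsOpenDisk D ∧ D ⊆ idealTriangle 𝒟 ∧ ∀ j, ∃ p : ℂ, closure D ∩ closure (𝒟 j) = {p}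

/-- The inscribed disk `D_in(𝒟)` of the ideal triangle of `𝒟`. -/
noncomputable def Din (𝒟 : Fin 3 → Set ℂ) : Set ℂ := Classical.epsilon (IsInscribedDisk 𝒟)

/-- `Φ_j(𝒟)`: replace the `j`-th entry of `𝒟` by the inscribed disk `D_in(𝒟)`. -/
noncomputable def Phi (j : Fin 3) (𝒟 : Fin 3 → Set ℂ) : Fin 3 → Set ℂ :=
  Function.update 𝒟 j (Din 𝒟)

/-- Finite words over the alphabet `{1,2,3}` (represented by `Fin 3`). -/
abbrev Word := List (Fin 3)

/-- `𝒟_w = Φ_w(𝒟) = (Φ_{w_m} ∘ ⋯ ∘ Φ_{w_1})(𝒟)`. -/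
noncomputable def applyWord (𝒟 : Fin 3 → Set ℂ) (w : Word) : Fin 3 → Set ℂ :=
  w.foldl (fun D j => Phi j D) 𝒟

/-- The Apollonian gasket `K(𝒟)` associated with `𝒟`. -/
noncomputable def AG (𝒟 : Fin 3 → Set ℂ) : Set ℂ :=
  closure (idealTriangle 𝒟) \ ⋃ w : Word, Din (applyWord 𝒟 w)

/-- A concrete positively oriented tangential disk triple. -/
noncomputable def baseTriple : Fin 3 → Set ℂ :=
  ![{z : ℂ | 1 < z.im},
    Metric.ball (Complex.I / 2 - 1 / 2) (1 / 2),
    Metric.ball (Complex.I / 2 + 1 / 2) (1 / 2)]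

/-- `d`, the Hausdorff dimension of the Apollonian gasket
(independent of the choice of `𝒟 ∈ TDT⁺`). -/
noncomputable def dAG : ℝ := (dimH (AG baseTriple)).toReal

/-- The matrices `M₁, M₂, M₃`. -/
def Mmat : Fin 3 → Matrix (Fin 4) (Fin 4) ℝ :=
  ![!![1,0,0,0; 1,1,0,1; 1,0,1,1; 2,0,0,1],
    !![1,1,0,1; 0,1,0,0; 0,1,1,1; 0,2,0,1],
    !![1,0,1,1; 0,1,1,1; 0,0,1,0; 0,0,2,1]]

/-- `M_w := M_{w₁} ⋯ M_{w_m}` (`M_∅` is the identity matrix). -/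
def Mword (w : Word) : Matrix (Fin 4) (Fin 4) ℝ := (w.map Mmat).prod

/-- `κ(α,β,γ) := √(βγ + γα + αβ)`. -/
noncomputable def kappa (α β γ : ℝ) : ℝ := Real.sqrt (β * γ + γ * α + α * β)

/-- The row vector `(curv D₁, curv D₂, curv D₃, κ(𝒟))`. -/
noncomputable def curvVec (𝒟 : Fin 3 → Set ℂ) : Fin 4 → ℝ :=
  ![curv (𝒟 0), curv (𝒟 1), curv (𝒟 2),
    kappa (curv (𝒟 0)) (curv (𝒟 1)) (curv (𝒟 2))]

/-- The parameter space `Γ = {(g, κ(g)) : g ∈ [0,∞)³, κ(g) > 0} ⊆ [0,∞)⁴`. -/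
def Gamma : Set (Fin 4 → ℝ) :=
  {g | 0 ≤ g 0 ∧ 0 ≤ g 1 ∧ 0 ≤ g 2 ∧ g 3 = kappa (g 0) (g 1) (g 2) ∧ 0 < g 3}

/-- `Γ° := Γ ∩ (0,∞)⁴`. -/
def GammaInt : Set (Fin 4 → ℝ) := {g | g ∈ Gamma ∧ ∀ i, 0 < g i}

/-- The compact subset `Γ_ε` of `Γ`. -/
def GammaEps (ε : ℝ) : Set (Fin 4 → ℝ) :=
  {g | g 0 ∈ Set.Icc 0 ε⁻¹ ∧ g 1 ∈ Set.Icc 0 ε⁻¹ ∧ g 2 ∈ Set.Icc 0 ε⁻¹ ∧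
       g 3 = kappa (g 0) (g 1) (g 2) ∧
       ε ≤ g 1 + g 2 ∧ ε ≤ g 2 + g 0 ∧ ε ≤ g 0 + g 1}

/-- The Euclidean norm on `ℝ⁴`. -/
noncomputable def euclNorm4 (g : Fin 4 → ℝ) : ℝ := Real.sqrt (∑ i, g i ^ 2)

/-- The metric `ρ_Γ` on `Γ`: the Euclidean distance of the first three coordinates. -/
noncomputable def rhoGamma (g₁ g₂ : Fin 4 → ℝ) : ℝ :=
  Real.sqrt ((g₁ 0 - g₂ 0) ^ 2 + (g₁ 1 - g₂ 1) ^ 2 + (g₁ 2 - g₂ 2) ^ 2)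

/-- A positively oriented tangential disk triple with prescribed curvatures
`(g 0, g 1, g 2)` (junk value if none exists). -/
noncomputable def tripleOf (g : Fin 4 → ℝ) : Fin 3 → Set ℂ :=
  Classical.epsilon fun 𝒟 : Fin 3 → Set ℂ =>
    IsTDTplus 𝒟 ∧ curv (𝒟 0) = g 0 ∧ curv (𝒟 1) = g 1 ∧ curv (𝒟 2) = g 2

/-- `ℋ_Γ(g)`: the `d`-dimensional Hausdorff measure of the Apollonian gasket `K(𝒟)`
for any `𝒟 ∈ TDT⁺` whose members have curvatures `(g 0, g 1, g 2)`. -/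
noncomputable def HGamma (g : Fin 4 → ℝ) : ℝ :=
  (μH[dAG] (AG (tripleOf g))).toReal

/-- The operator norm of a `4 × 4` real matrix with respect to the Euclidean norm on `ℝ⁴`. -/
noncomputable def opNorm4 (M : Matrix (Fin 4) (Fin 4) ℝ) : ℝ :=
  sSup {t : ℝ | ∃ v : Fin 4 → ℝ, euclNorm4 v ≤ 1 ∧ t = euclNorm4 (M.mulVec v)}

/-- The set of words `I = {jⁿk : j,k ∈ S, j ≠ k, n ∈ ℕ}`. -/
def IdxI : Set Word :=
  {w | ∃ j k : Fin 3, j ≠ k ∧ ∃ n : ℕ, 0 < n ∧ w = List.replicate n j ++ [k]}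

end

noncomputable section

/-- The circle `∂E` (boundary of the open disk `E`) is orthogonal to the boundary of `D`:
if `D` is a disk this is the usual orthogonality of circles, and if `D` is a half-plane
this means the center of `E` lies on the boundary line of `D`. -/
def OrthToBoundary (E D : Set ℂ) : Prop :=
  (IsOpenDisk D →
    dist (diskCenter E) (diskCenter D) ^ 2 = diskRadius E ^ 2 + diskRadius D ^ 2) ∧
  (IsOpenHalfPlane D → diskCenter E ∈ frontier D)

/-! ### Disks and half-planes as sublevel sets of quadratic forms -/

lemma ball_inj_of_pos {z z' : ℂ} {r r' : ℝ} (hr : 0 < r) (hr' : 0 < r')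
    (h : Metric.ball z r = Metric.ball z' r') : z = z' ∧ r = r' := by
  have h2 : r = r' := by
    have h1 := congrArg Metric.diam h
    rw [Metric.diam_ball_eq z hr.le, Metric.diam_ball_eq z' hr'.le] at h1
    linarith
  subst h2
  refine ⟨?_, rfl⟩
  by_contra hne
  have hd : 0 < ‖z' - z‖ := norm_pos_iff.2 (sub_ne_zero.2 (Ne.symm hne))
  have hc : closure (Metric.ball z r) = closure (Metric.ball z' r) := by rw [h]
  rw [closure_ball z hr.ne', closure_ball z' hr.ne'] at hc
  have hnorm : ‖((r / ‖z' - z‖ : ℝ) : ℂ)‖ = r / ‖z' - z‖ := by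
    rw [Complex.norm_real, Real.norm_of_nonneg (by positivity)]
  have hm : z' + ((r / ‖z' - z‖ : ℝ) : ℂ) * (z' - z) ∈ Metric.closedBall z' r := by
    rw [mem_closedBall_iff_norm, add_sub_cancel_left, norm_mul, hnorm, div_mul_cancel₀ _ hd.ne']
  rw [← hc, mem_closedBall_iff_norm] at hm
  have he : z' + ((r / ‖z' - z‖ : ℝ) : ℂ) * (z' - z) - z
      = ((1 + r / ‖z' - z‖ : ℝ) : ℂ) * (z' - z) := by
    push_cast; ring
  rw [he, norm_mul, Complex.norm_real, Real.norm_of_nonneg (by positivity), add_mul,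
    div_mul_cancel₀ _ hd.ne'] at hm
  linarith

lemma diskCenter_ball (z : ℂ) {r : ℝ} (hr : 0 < r) : diskCenter (Metric.ball z r) = z := by
  have h : ∃ r' : ℝ, 0 < r' ∧
      Metric.ball z r = Metric.ball (diskCenter (Metric.ball z r)) r' :=
    Classical.epsilon_spec
      (p := fun c : ℂ => ∃ r' : ℝ, 0 < r' ∧ Metric.ball z r = Metric.ball c r') ⟨z, r, hr, rfl⟩
  obtain ⟨r', hr', h⟩ := h
  exact (ball_inj_of_pos hr hr' h).1.symm

lemma diskRadius_ball (z : ℂ) {r : ℝ} (hr : 0 < r) : diskRadius (Metric.ball z r) = r := by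
  have h : 0 < diskRadius (Metric.ball z r) ∧
      ∃ z' : ℂ, Metric.ball z r = Metric.ball z' (diskRadius (Metric.ball z r)) :=
    Classical.epsilon_spec
      (p := fun s : ℝ => 0 < s ∧ ∃ z' : ℂ, Metric.ball z r = Metric.ball z' s) ⟨r, hr, z, rfl⟩
  obtain ⟨hr', z', h⟩ := h
  exact (ball_inj_of_pos hr hr' h).2.symm

lemma curv_ball (z : ℂ) {r : ℝ} (hr : 0 < r) : curv (Metric.ball z r) = r⁻¹ := by
  have h : IsOpenDisk (Metric.ball z r) := ⟨z, r, hr, rfl⟩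
  simp only [curv, if_pos h, diskRadius_ball z hr]

lemma IsOpenHalfPlane.not_isOpenDisk {D : Set ℂ} (h : IsOpenHalfPlane D) : ¬ IsOpenDisk D := by
  rintro ⟨z, r, hr, rfl⟩
  obtain ⟨a, ha, c, h⟩ := h
  obtain ⟨C, hC⟩ := (Metric.isBounded_ball (x := z) (r := r)).exists_norm_le
  have ha' : 0 < ‖a‖ := norm_pos_iff.2 ha
  have key : ∀ t : ℝ, t < c → |t| ≤ ‖a‖ * C := by
    intro t ht
    have e : a * ((t : ℂ) / a) = t := mul_div_cancel₀ _ ha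
    have hm : (t : ℂ) / a ∈ Metric.ball z r := by
      rw [h]
      show (a * ((t : ℂ) / a)).re < c
      rw [e]; simpa using ht
    have h1 := hC _ hm
    rw [norm_div, Complex.norm_real, Real.norm_eq_abs, div_le_iff₀ ha'] at h1
    linarith
  have h1 := key (-(|c| + |‖a‖ * C| + 1)) (by
    have := neg_abs_le c
    have := abs_nonneg (‖a‖ * C)
    linarith)
  rw [abs_neg, abs_of_pos (by positivity)] at h1
  have := le_abs_self (‖a‖ * C)
  have := abs_nonneg c
  linarith

/-- The real quadratic form `v ↦ A |v|² + 2 ⟨n, v⟩ + e` on the plane. -/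
def circleForm (A : ℝ) (n : ℂ) (e : ℝ) (v : ℂ) : ℝ :=
  A * (v.re ^ 2 + v.im ^ 2) + 2 * (n.re * v.re + n.im * v.im) + e

lemma continuous_circleForm (A : ℝ) (n : ℂ) (e : ℝ) (w : ℂ) :
    Continuous fun z => circleForm A n e (z - w) := by
  unfold circleForm
  fun_prop

/-- `D` is the open sublevel set of the normalized quadratic form with coefficients `A`, `n`, `e`
centered at `w`, where `A` is the curvature of `D`. -/
structure IsCircleForm (D : Set ℂ) (w : ℂ) (A : ℝ) (n : ℂ) (e : ℝ) : Prop where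
  mem_iff : ∀ z, z ∈ D ↔ circleForm A n e (z - w) < 0
  mem_closure_iff : ∀ z, z ∈ closure D ↔ circleForm A n e (z - w) ≤ 0
  normalized : n.re ^ 2 + n.im ^ 2 = 1 + A * e
  curv_eq : curv D = A
  nonneg : 0 ≤ A
  pos : IsOpenDisk D → 0 < A
  orth : ∀ R : ℝ, 0 < R → e = A * R ^ 2 → OrthToBoundary (Metric.ball w R) D

lemma IsCircleForm.isOpen {D : Set ℂ} {w : ℂ} {A : ℝ} {n : ℂ} {e : ℝ}
    (h : IsCircleForm D w A n e) : IsOpen D := by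
  have : D = {z | circleForm A n e (z - w) < 0} := Set.ext h.mem_iff
  rw [this]
  exact isOpen_lt (continuous_circleForm A n e w) continuous_const

lemma dist_sq_eq (z w : ℂ) : dist z w ^ 2 = (z.re - w.re) ^ 2 + (z.im - w.im) ^ 2 := by
  rw [Complex.dist_eq_re_im, Real.sq_sqrt (by positivity)]

lemma IsOpenDisk.exists_isCircleForm {D : Set ℂ} (h : IsOpenDisk D) (w : ℂ) :
    ∃ A n e, IsCircleForm D w A n e := by
  obtain ⟨c, r, hr, rfl⟩ := h
  have key : ∀ z : ℂ, circleForm r⁻¹ ⟨(w.re - c.re) / r, (w.im - c.im) / r⟩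
      ((dist w c ^ 2 - r ^ 2) / r) (z - w) = (dist z c ^ 2 - r ^ 2) / r := by
    intro z
    simp only [circleForm, dist_sq_eq, Complex.sub_re, Complex.sub_im]
    field_simp
    ring
  refine ⟨r⁻¹, ⟨(w.re - c.re) / r, (w.im - c.im) / r⟩, (dist w c ^ 2 - r ^ 2) / r,
    fun z => ?_, fun z => ?_, ?_, curv_ball c hr, by positivity, fun _ => by positivity, ?_⟩
  · rw [key, Metric.mem_ball, div_lt_iff₀ hr, zero_mul, sub_neg,
      sq_lt_sq₀ dist_nonneg hr.le]
  · rw [key, closure_ball c hr.ne', Metric.mem_closedBall, div_le_iff₀ hr, zero_mul, sub_nonpos,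
      sq_le_sq₀ dist_nonneg hr.le]
  · rw [dist_sq_eq]
    field_simp
    ring
  · intro R hR he
    refine ⟨fun _ => ?_, fun hp => absurd ⟨c, r, hr, rfl⟩ hp.not_isOpenDisk⟩
    rw [diskCenter_ball w hR, diskCenter_ball c hr, diskRadius_ball w hR, diskRadius_ball c hr]
    field_simp at he
    linarith

lemma IsOpenHalfPlane.exists_isCircleForm {D : Set ℂ} (h : IsOpenHalfPlane D) (w : ℂ) :
    ∃ A n e, IsCircleForm D w A n e := by
  have hnd := h.not_isOpenDisk
  obtain ⟨a, ha, c, rfl⟩ := h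
  have hN : 0 < ‖a‖ := norm_pos_iff.2 ha
  have key : ∀ z : ℂ, circleForm 0 ⟨a.re / ‖a‖, -a.im / ‖a‖⟩
      (2 * ((a * w).re - c) / ‖a‖) (z - w) = 2 * ((a * z).re - c) / ‖a‖ := by
    intro z
    simp only [circleForm, Complex.sub_re, Complex.sub_im, Complex.mul_re]
    field_simp
    ring
  have hcl : closure {z : ℂ | (a * z).re < c} = {z : ℂ | (a * z).re ≤ c} := by
    have h1 : {z : ℂ | (a * z).re < c} = (Homeomorph.mulLeft₀ a ha) ⁻¹' {z : ℂ | z.re < c} := rfl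
    rw [h1, ← Homeomorph.preimage_closure, Complex.closure_setOfPred_re_lt]
    rfl
  have hlt : ∀ z : ℂ, 2 * ((a * z).re - c) / ‖a‖ < 0 ↔ (a * z).re < c := by
    intro z
    rw [div_lt_iff₀ hN, zero_mul]
    constructor <;> intro _ <;> linarith
  have hopen : IsOpen {z : ℂ | (a * z).re < c} :=
    isOpen_lt (by fun_prop) continuous_const
  refine ⟨0, ⟨a.re / ‖a‖, -a.im / ‖a‖⟩, 2 * ((a * w).re - c) / ‖a‖,
    fun z => ?_, fun z => ?_, ?_, ?_, le_rfl, fun h => absurd h hnd, ?_⟩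
  · rw [key, hlt]; rfl
  · rw [key, hcl, div_le_iff₀ hN, zero_mul]
    show (a * z).re ≤ c ↔ _
    constructor <;> intro _ <;> linarith
  · have : ‖a‖ ^ 2 = a.re ^ 2 + a.im ^ 2 := by
      rw [Complex.sq_norm, Complex.normSq_apply]; ring
    field_simp
    linarith
  · simp only [curv, if_neg hnd]
  · intro R hR he
    refine ⟨fun h => absurd h hnd, fun _ => ?_⟩
    rw [diskCenter_ball w hR, hopen.frontier_eq, hcl]
    have : (a * w).re = c := by
      field_simp at he
      linarith
    exact ⟨this.le, fun h => (ne_of_lt h) this⟩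

/-! ### Tangency -/

lemma notMem_of_closure_inter_eq_singleton {U V : Set ℂ} {p : ℂ} (hU : IsOpen U) (hV : IsOpen V)
    (h : closure U ∩ closure V = {p}) : p ∉ U := by
  intro hpU
  have hpm : p ∈ closure U ∩ closure V := h ▸ Set.mem_singleton p
  have hne : (U ∩ V).Nonempty := mem_closure_iff.1 hpm.2 U hU hpU
  have hs : U ∩ V ⊆ {p} := h ▸ Set.inter_subset_inter subset_closure subset_closure
  have ho : IsOpen (U ∩ V) := hU.inter hV
  rw [hne.subset_singleton_iff.1 hs] at ho
  exact not_isOpen_singleton p ho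

lemma IsCircleForm.eq_zero_of_tangent {D V : Set ℂ} {w n p : ℂ} {A e : ℝ}
    (h : IsCircleForm D w A n e) (hV : IsOpen V) (hp : closure D ∩ closure V = {p}) :
    circleForm A n e (p - w) = 0 := by
  have hpm : p ∈ closure D ∩ closure V := hp ▸ Set.mem_singleton p
  have h1 := (h.mem_closure_iff p).1 hpm.1
  have h2 := (h.mem_iff p).not.1 (notMem_of_closure_inter_eq_singleton h.isOpen hV hp)
  linarith

/-- The normalized forms of two tangent disks add up to a multiple of the squared distance to
the point of tangency. -/
lemma circleForm_add_of_tangent {D D' : Set ℂ} {w n n' p : ℂ} {A e A' e' : ℝ}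
    (h : IsCircleForm D w A n e) (h' : IsCircleForm D' w A' n' e')
    (hp : closure D ∩ closure D' = {p}) :
    n.re + n'.re = -(A + A') * (p - w).re ∧ n.im + n'.im = -(A + A') * (p - w).im ∧
      e + e' = (A + A') * ((p - w).re ^ 2 + (p - w).im ^ 2) := by
  have hF := h.eq_zero_of_tangent h'.isOpen hp
  have hF' := h'.eq_zero_of_tangent h.isOpen (Set.inter_comm _ _ ▸ hp)
  have hn := h.normalized
  have hn' := h'.normalized
  have hA := h.nonneg
  have hA' := h'.nonneg
  obtain ⟨u, hu⟩ : ∃ u, u = p - w := ⟨_, rfl⟩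
  rw [← hu] at hF hF' ⊢
  obtain ⟨m, hm⟩ : ∃ m : ℂ, m = ⟨(A + A') * u.re + n.re + n'.re,
    (A + A') * u.im + n.im + n'.im⟩ := ⟨_, rfl⟩
  have hre : m.re = (A + A') * u.re + n.re + n'.re := by rw [hm]
  have him : m.im = (A + A') * u.im + n.im + n'.im := by rw [hm]
  obtain ⟨t, ht⟩ : ∃ t : ℝ, t = (1 + A + A')⁻¹ := ⟨_, rfl⟩
  have htpos : 0 < t := by rw [ht]; positivity
  have htA : t * (1 + A + A') = 1 := by rw [ht]; exact inv_mul_cancel₀ (by positivity)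
  have hg : (A * u.re + n.re) ^ 2 + (A * u.im + n.im) ^ 2 = 1 := by
    simp only [circleForm] at hF
    linear_combination A * hF + hn
  have hg' : (A' * u.re + n'.re) ^ 2 + (A' * u.im + n'.im) ^ 2 = 1 := by
    simp only [circleForm] at hF'
    linear_combination A' * hF' + hn'
  have hx : circleForm A n e (p - (t : ℂ) * m - w) = t * (A * t - 1) * (m.re ^ 2 + m.im ^ 2) ∧
      circleForm A' n' e' (p - (t : ℂ) * m - w) = t * (A' * t - 1) * (m.re ^ 2 + m.im ^ 2) := by
    have : p - (t : ℂ) * m - w = u - (t : ℂ) * m := by rw [hu]; ring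
    rw [this]
    simp only [circleForm, Complex.sub_re, Complex.sub_im, Complex.re_ofReal_mul,
      Complex.im_ofReal_mul, hre, him] at hF hF' ⊢
    constructor
    · linear_combination hF + t * (hg' - hg)
    · linear_combination hF' + t * (hg - hg')
  have hmem : p - (t : ℂ) * m ∈ closure D ∩ closure D' := by
    constructor
    · rw [h.mem_closure_iff, hx.1]
      exact mul_nonpos_of_nonpos_of_nonneg
        (mul_nonpos_of_nonneg_of_nonpos htpos.le (by nlinarith)) (by positivity)
    · rw [h'.mem_closure_iff, hx.2]
      exact mul_nonpos_of_nonpos_of_nonneg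
        (mul_nonpos_of_nonneg_of_nonpos htpos.le (by nlinarith)) (by positivity)
  rw [hp, Set.mem_singleton_iff, sub_eq_self, mul_eq_zero, Complex.ofReal_eq_zero] at hmem
  have hm0 := hmem.resolve_left htpos.ne'
  rw [hm0, Complex.zero_re] at hre
  rw [hm0, Complex.zero_im] at him
  refine ⟨by linarith, by linarith, ?_⟩
  simp only [circleForm] at hF hF'
  linear_combination hF + hF' + 2 * u.re * hre + 2 * u.im * him

/-! ### Three mutually tangent disks -/

/-- If three vectors of Minkowski space have square norm `1` and pairwise products `-1`, then the
Minkowski form is recovered from the products with these vectors. -/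
lemma minkowski_form_eq {x y s : Fin 3 → ℝ} (h1 : ∀ j, x j ^ 2 + y j ^ 2 - s j ^ 2 = 1)
    (h2 : ∀ j k, j ≠ k → x j * x k + y j * y k - s j * s k = -1) (X Y S : ℝ) :
    ((x 0 * X + y 0 * Y - s 0 * S) * (x 1 * X + y 1 * Y - s 1 * S) +
      (x 1 * X + y 1 * Y - s 1 * S) * (x 2 * X + y 2 * Y - s 2 * S) +
      (x 2 * X + y 2 * Y - s 2 * S) * (x 0 * X + y 0 * Y - s 0 * S))
      = S ^ 2 - X ^ 2 - Y ^ 2 := by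
  have a0 := h1 0
  have a1 := h1 1
  have a2 := h1 2
  have b0 := h2 1 2 (by decide)
  have b1 := h2 0 2 (by decide)
  have b2 := h2 0 1 (by decide)
  have hM : !![x 0, y 0, s 0; x 1, y 1, s 1; x 2, y 2, s 2] *
      !![-(x 1 + x 2) / 2, -(x 0 + x 2) / 2, -(x 0 + x 1) / 2;
        -(y 1 + y 2) / 2, -(y 0 + y 2) / 2, -(y 0 + y 1) / 2;
        (s 1 + s 2) / 2, (s 0 + s 2) / 2, (s 0 + s 1) / 2] = 1 := by
    ext i j
    fin_cases i <;> fin_cases j <;>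
      simp [Matrix.mul_apply, Fin.sum_univ_three] <;>
      linarith
  rw [mul_eq_one_comm] at hM
  have c : ∀ i j, _ := fun i j => congrFun (congrFun hM i) j
  have c00 := c 0 0
  have c01 := c 0 1
  have c02 := c 0 2
  have c11 := c 1 1
  have c12 := c 1 2
  have c22 := c 2 2
  simp [Matrix.mul_apply, Fin.sum_univ_three] at c00 c01 c02 c11 c12 c22
  linear_combination -X ^ 2 * c00 - 2 * X * Y * c01 + 2 * X * S * c02 - Y ^ 2 * c11
    + 2 * Y * S * c12 + S ^ 2 * c22

/-- On a ray leaving the circle of radius `R`, positivity of the form of an orthogonal disk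
persists. -/
lemma circleForm_ray_pos {A R t : ℝ} {n v : ℂ} (hA : 0 ≤ A) (hv : R ^ 2 ≤ v.re ^ 2 + v.im ^ 2)
    (ht : 1 ≤ t) (h : 0 < circleForm A n (A * R ^ 2) v) :
    0 < circleForm A n (A * R ^ 2) ((t : ℂ) * v) := by
  have e : circleForm A n (A * R ^ 2) ((t : ℂ) * v) = t * circleForm A n (A * R ^ 2) v +
      A * ((t - 1) * (t * (v.re ^ 2 + v.im ^ 2) - R ^ 2)) := by
    simp only [circleForm, Complex.re_ofReal_mul, Complex.im_ofReal_mul]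
    ring
  rw [e]
  have h1 : 0 < t * circleForm A n (A * R ^ 2) v := by positivity
  have h2 : 0 ≤ t * (v.re ^ 2 + v.im ^ 2) - R ^ 2 := by nlinarith [sq_nonneg v.re, sq_nonneg v.im]
  have h3 : 0 ≤ A * ((t - 1) * (t * (v.re ^ 2 + v.im ^ 2) - R ^ 2)) :=
    mul_nonneg hA (mul_nonneg (by linarith) h2)
  linarith

/-- A bounded component of the exterior of disks orthogonal to a circle lies inside the circle. -/
lemma connectedComponentIn_subset_ball {ι : Type*} {A : ι → ℝ} {n : ι → ℂ} {w z₀ : ℂ} {R : ℝ}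
    (hR : 0 < R) (hA : ∀ j, 0 ≤ A j)
    (hb : Bornology.IsBounded (connectedComponentIn
      {z | ∀ j, 0 < circleForm (A j) (n j) (A j * R ^ 2) (z - w)} z₀)) :
    connectedComponentIn {z | ∀ j, 0 < circleForm (A j) (n j) (A j * R ^ 2) (z - w)} z₀
      ⊆ Metric.ball w R := by
  intro z hz
  by_contra hzR
  rw [Metric.mem_ball, not_lt] at hzR
  have hzU := connectedComponentIn_subset _ _ hz
  have hsq : R ^ 2 ≤ (z - w).re ^ 2 + (z - w).im ^ 2 := by
    have := dist_sq_eq z w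
    rw [Complex.sub_re, Complex.sub_im, ← this]
    gcongr
  have hray : (fun t : ℝ => w + (t : ℂ) * (z - w)) '' Set.Ici 1 ⊆
      connectedComponentIn {z | ∀ j, 0 < circleForm (A j) (n j) (A j * R ^ 2) (z - w)} z₀ := by
    rw [connectedComponentIn_eq hz]
    refine (isPreconnected_Ici.image _ (by fun_prop)).subset_connectedComponentIn
      ⟨1, Set.self_mem_Ici, by simp⟩ ?_
    rintro _ ⟨t, ht, rfl⟩ j
    rw [add_sub_cancel_left]
    exact circleForm_ray_pos (hA j) hsq ht (hzU j)
  obtain ⟨C, hC⟩ := (hb.subset hray).subset_ball w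
  have hm := hC ⟨1 + |C| / R, by simp only [Set.mem_Ici]; linarith [show 0 ≤ |C| / R by positivity],
    rfl⟩
  rw [Metric.mem_ball, dist_eq_norm, add_sub_cancel_left, norm_mul, Complex.norm_real,
    Real.norm_of_nonneg (by positivity), ← dist_eq_norm] at hm
  have : (1 + |C| / R) * R ≤ (1 + |C| / R) * dist z w := by gcongr
  have e : (1 + |C| / R) * R = R + |C| := by field_simp
  linarith [le_abs_self C]

lemma connectedComponentIn_subset_ball_of_disjoint_sphere {U : Set ℂ} {w z₀ : ℂ} {R : ℝ}
    (hz₀ : z₀ ∈ Metric.ball w R) (hU : ∀ z ∈ U, dist z w ≠ R) :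
    connectedComponentIn U z₀ ⊆ Metric.ball w R := by
  by_cases hz : z₀ ∈ U
  · refine isPreconnected_connectedComponentIn.subset_left_of_subset_union Metric.isOpen_ball
      (Metric.isClosed_closedBall (x := w) (ε := R)).isOpen_compl ?_ ?_
      ⟨z₀, mem_connectedComponentIn hz, hz₀⟩
    · exact Set.disjoint_compl_right_iff_subset.2 Metric.ball_subset_closedBall
    · intro z hzc
      have := hU z (connectedComponentIn_subset _ _ hzc)
      rcases lt_or_gt_of_ne this with h | h
      · exact Or.inl h
      · exact Or.inr (by simpa using h)
  · rw [connectedComponentIn_eq_empty hz]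
    exact Set.empty_subset _

lemma exists_mem_ball_circleForm_pos {ι : Type*} [Finite ι] {A : ι → ℝ} {n : ι → ℂ} {w : ℂ} {R : ℝ}
    (hR : 0 < R) (j₀ : ι) (hA₀ : 0 ≤ A j₀) (hn₀ : n j₀ ≠ 0) (hA : ∀ j, j ≠ j₀ → 0 < A j) :
    ∃ z ∈ Metric.ball w R, ∀ j, 0 < circleForm (A j) (n j) (A j * R ^ 2) (z - w) := by
  have hcont : Continuous fun t : ℝ => w + (t : ℂ) * n j₀ := by fun_prop
  have hball : ∀ᶠ t : ℝ in 𝓝[>] 0, w + (t : ℂ) * n j₀ ∈ Metric.ball w R :=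
    nhdsWithin_le_nhds ((hcont.tendsto 0).eventually_mem
      (Metric.isOpen_ball.mem_nhds (by simpa using hR)))
  have hpos : ∀ j, ∀ᶠ t : ℝ in 𝓝[>] 0,
      0 < circleForm (A j) (n j) (A j * R ^ 2) (w + (t : ℂ) * n j₀ - w) := by
    intro j
    by_cases hj : j = j₀
    · subst hj
      filter_upwards [self_mem_nhdsWithin] with t ht
      have ht' : 0 < t := ht
      have hn : 0 < (n j).re ^ 2 + (n j).im ^ 2 := by
        have := Complex.normSq_pos.2 hn₀
        rw [Complex.normSq_apply] at this
        nlinarith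
      rw [add_sub_cancel_left]
      simp only [circleForm, Complex.re_ofReal_mul, Complex.im_ofReal_mul]
      have h1 : 0 < 2 * (t * ((n j).re ^ 2 + (n j).im ^ 2)) := by positivity
      have h2 : 0 ≤ A j * ((t * (n j).re) ^ 2 + (t * (n j).im) ^ 2) + A j * R ^ 2 := by positivity
      linarith
    · refine nhdsWithin_le_nhds ((((continuous_circleForm (A j) (n j) (A j * R ^ 2) w).comp
        hcont).tendsto 0).eventually (lt_mem_nhds ?_))
      have := hA j hj
      simp only [circleForm, Function.comp]
      simp
      positivity
  obtain ⟨t, ht, ht'⟩ := (hball.and (eventually_all.2 hpos)).exists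
  exact ⟨_, ht, ht'⟩

lemma closure_inter_closure_tangencyPoint {𝒟 : Fin 3 → Set ℂ} (h : IsTDT 𝒟) (j : Fin 3) :
    closure (𝒟 (j + 1)) ∩ closure (𝒟 (j + 2)) = {tangencyPoint 𝒟 j} :=
  Classical.epsilon_spec (p := fun p : ℂ => closure (𝒟 (j + 1)) ∩ closure (𝒟 (j + 2)) = {p})
    (h.2 _ _ (by fin_cases j <;> decide))

lemma IsTDT.exists_forall_ne_isOpenDisk {𝒟 : Fin 3 → Set ℂ} (h : IsTDT 𝒟) :
    ∃ j₀, (IsOpenDisk (𝒟 j₀) ∨ IsOpenHalfPlane (𝒟 j₀)) ∧ ∀ j, j ≠ j₀ → IsOpenDisk (𝒟 j) := by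
  rcases h.1 with h | ⟨j, hj, h⟩
  · exact ⟨0, Or.inl (h 0), fun j _ => h j⟩
  · exact ⟨j, Or.inr hj, h⟩


/-- properties of the circumscribed disk of the ideal triangle. -/
theorem circumscribedDisk_orth_subset_curv
    (𝒟 : Fin 3 → Set ℂ) (h𝒟 : IsTDTplus 𝒟)
    (Dcir : Set ℂ) (hdisk : IsOpenDisk Dcir)
    (hq : ∀ j : Fin 3, tangencyPoint 𝒟 j ∈ frontier Dcir) :
    (∀ j : Fin 3, OrthToBoundary Dcir (𝒟 j)) ∧
    closure (idealTriangle 𝒟) \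
      {tangencyPoint 𝒟 0, tangencyPoint 𝒟 1, tangencyPoint 𝒟 2} ⊆ Dcir ∧
    curv Dcir = kappa (curv (𝒟 0)) (curv (𝒟 1)) (curv (𝒟 2)) := by
  obtain ⟨hT, -⟩ := h𝒟
  obtain ⟨w, R, hR, rfl⟩ := hdisk
  obtain ⟨j₀, hj₀, hdisk⟩ := hT.exists_forall_ne_isOpenDisk
  have hex : ∀ j, ∃ A n e, IsCircleForm (𝒟 j) w A n e := by
    intro j
    by_cases hj : j = j₀
    · subst hj
      exact hj₀.elim (fun h => h.exists_isCircleForm w) fun h => h.exists_isCircleForm w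
    · exact (hdisk j hj).exists_isCircleForm w
  choose A n e hF using hex
  have hApos : ∀ j, j ≠ j₀ → 0 < A j := fun j hj => (hF j).pos (hdisk j hj)
  have hqR : ∀ j, (tangencyPoint 𝒟 j - w).re ^ 2 + (tangencyPoint 𝒟 j - w).im ^ 2 = R ^ 2 := by
    intro j
    have := hq j
    rw [frontier_ball w hR.ne', Metric.mem_sphere] at this
    rw [← this, dist_sq_eq, Complex.sub_re, Complex.sub_im]
  have htan := fun j => circleForm_add_of_tangent (hF (j + 1)) (hF (j + 2))
    (closure_inter_closure_tangencyPoint hT j)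
  have hAsum : ∀ j, 0 < A (j + 1) + A (j + 2) := by
    intro j
    have h1 := (hF (j + 1)).nonneg
    have h2 := (hF (j + 2)).nonneg
    by_cases h : j + 1 = j₀
    · have := hApos (j + 2) (by rw [← h]; fin_cases j <;> decide)
      linarith
    · have := hApos (j + 1) h
      linarith
  have he : ∀ j, e j = A j * R ^ 2 := by
    have h : ∀ j, e (j + 1) + e (j + 2) = (A (j + 1) + A (j + 2)) * R ^ 2 := fun j => by
      rw [(htan j).2.2, hqR]
    have h0 : e 1 + e 2 = (A 1 + A 2) * R ^ 2 := h 0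
    have h1 : e 2 + e 0 = (A 2 + A 0) * R ^ 2 := h 1
    have h2 : e 0 + e 1 = (A 0 + A 1) * R ^ 2 := h 2
    intro j
    fin_cases j
    · show e 0 = A 0 * R ^ 2
      linarith
    · show e 1 = A 1 * R ^ 2
      linarith
    · show e 2 = A 2 * R ^ 2
      linarith
  have hnorm : ∀ j, (n j).re ^ 2 + (n j).im ^ 2 - (A j * R) ^ 2 = 1 := fun j => by
    rw [(hF j).normalized, he]; ring
  have hprod : ∀ j, (n (j + 1)).re * (n (j + 2)).re + (n (j + 1)).im * (n (j + 2)).im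
      - A (j + 1) * R * (A (j + 2) * R) = -1 := by
    intro j
    have hs : ((n (j + 1)).re + (n (j + 2)).re) ^ 2 + ((n (j + 1)).im + (n (j + 2)).im) ^ 2
        = (A (j + 1) + A (j + 2)) ^ 2 * R ^ 2 := by
      rw [(htan j).1, (htan j).2.1, ← hqR j]; ring
    linear_combination hs / 2 - hnorm (j + 1) / 2 - hnorm (j + 2) / 2
  have hprod' : ∀ j k, j ≠ k → (n j).re * (n k).re + (n j).im * (n k).im
      - A j * R * (A k * R) = -1 := by
    have h0 : (n 1).re * (n 2).re + (n 1).im * (n 2).im - A 1 * R * (A 2 * R) = -1 := hprod 0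
    have h1 : (n 2).re * (n 0).re + (n 2).im * (n 0).im - A 2 * R * (A 0 * R) = -1 := hprod 1
    have h2 : (n 0).re * (n 1).re + (n 0).im * (n 1).im - A 0 * R * (A 1 * R) = -1 := hprod 2
    intro j k hjk
    fin_cases j <;> fin_cases k <;> first | exact absurd rfl hjk | (simp; linarith)
  have hmink := minkowski_form_eq (x := fun j => (n j).re) (y := fun j => (n j).im)
    (s := fun j => A j * R) hnorm hprod'
  have hsphere : ∀ z, dist z w = R → (∀ j, 0 ≤ circleForm (A j) (n j) (A j * R ^ 2) (z - w)) →
      ∃ j, z = tangencyPoint 𝒟 j := by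
    intro z hz hpos
    have hz2 : (z - w).re ^ 2 + (z - w).im ^ 2 = R ^ 2 := by
      rw [← hz, dist_sq_eq, Complex.sub_re, Complex.sub_im]
    have hf : ∀ j, circleForm (A j) (n j) (A j * R ^ 2) (z - w) =
        2 * ((n j).re * (z - w).re + (n j).im * (z - w).im - A j * R * -R) := by
      intro j
      simp only [circleForm, hz2]; ring
    have hsum : ∀ j, circleForm (A (j + 1)) (n (j + 1)) (A (j + 1) * R ^ 2) (z - w) = 0 →
        circleForm (A (j + 2)) (n (j + 2)) (A (j + 2) * R ^ 2) (z - w) = 0 →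
        z = tangencyPoint 𝒟 j := by
      intro j h1 h2
      rw [hf] at h1 h2
      obtain ⟨t1, t2, -⟩ := htan j
      have h0 : (A (j + 1) + A (j + 2)) * dist z (tangencyPoint 𝒟 j) ^ 2 = 0 := by
        rw [dist_sq_eq]
        have hq2 := hqR j
        simp only [Complex.sub_re, Complex.sub_im] at *
        linear_combination h1 + h2 + (A (j + 1) + A (j + 2)) * hz2
          + (A (j + 1) + A (j + 2)) * hq2 - 2 * (z.re - w.re) * t1 - 2 * (z.im - w.im) * t2
      exact dist_eq_zero.1 (pow_eq_zero_iff two_ne_zero |>.1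
        ((mul_eq_zero.1 h0).resolve_left (hAsum j).ne'))
    have hzero := hmink (z - w).re (z - w).im (-R)
    have hfpos := hpos
    simp only [hf] at hfpos hsum
    have p0 := hfpos 0
    have p1 := hfpos 1
    have p2 := hfpos 2
    generalize hg0 : (n 0).re * (z - w).re + (n 0).im * (z - w).im - A 0 * R * -R = g0 at *
    generalize hg1 : (n 1).re * (z - w).re + (n 1).im * (z - w).im - A 1 * R * -R = g1 at *
    generalize hg2 : (n 2).re * (z - w).re + (n 2).im * (z - w).im - A 2 * R * -R = g2 at *
    have s0 : 2 * g1 = 0 → 2 * g2 = 0 → z = tangencyPoint 𝒟 0 := hg1 ▸ hg2 ▸ hsum 0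
    have s1 : 2 * g2 = 0 → 2 * g0 = 0 → z = tangencyPoint 𝒟 1 := hg0 ▸ hg2 ▸ hsum 1
    have s2 : 2 * g0 = 0 → 2 * g1 = 0 → z = tangencyPoint 𝒟 2 := hg0 ▸ hg1 ▸ hsum 2
    have p0' : 0 ≤ g0 := by linarith
    have p1' : 0 ≤ g1 := by linarith
    have p2' : 0 ≤ g2 := by linarith
    have m01 := mul_nonneg p0' p1'
    have m12 := mul_nonneg p1' p2'
    have m20 := mul_nonneg p2' p0'
    have z01 : g0 * g1 = 0 := by nlinarith
    have z12 : g1 * g2 = 0 := by nlinarith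
    have z20 : g2 * g0 = 0 := by nlinarith
    rcases mul_eq_zero.1 z01 with h | h
    · rcases mul_eq_zero.1 z12 with h' | h'
      · exact ⟨2, s2 (by simp [h]) (by simp [h'])⟩
      · exact ⟨1, s1 (by simp [h']) (by simp [h])⟩
    · rcases mul_eq_zero.1 z20 with h' | h'
      · exact ⟨0, s0 (by simp [h]) (by simp [h'])⟩
      · exact ⟨2, s2 (by simp [h']) (by simp [h])⟩
  have hcompl : (⋃ j, closure (𝒟 j))ᶜ =
      {z | ∀ j, 0 < circleForm (A j) (n j) (A j * R ^ 2) (z - w)} := by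
    ext z
    simp only [Set.mem_compl_iff, Set.mem_iUnion, (hF _).mem_closure_iff, he, not_exists, not_le]
    rfl
  have hdisj : ∀ z ∈ (⋃ j, closure (𝒟 j))ᶜ, dist z w ≠ R := by
    intro z hz hzR
    obtain ⟨j, rfl⟩ := hsphere z hzR fun j => by rw [hcompl] at hz; exact (hz j).le
    have : tangencyPoint 𝒟 j ∈ closure (𝒟 (j + 1)) ∩ closure (𝒟 (j + 2)) := by
      rw [closure_inter_closure_tangencyPoint hT]; rfl
    exact hz (Set.mem_iUnion.2 ⟨_, this.1⟩)
  have htri : Bornology.IsBounded (idealTriangle 𝒟) ∧ ∃ z ∈ (⋃ j, closure (𝒟 j))ᶜ,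
      idealTriangle 𝒟 = connectedComponentIn (⋃ j, closure (𝒟 j))ᶜ z := by
    have hn₀ : n j₀ ≠ 0 := by
      intro h
      have := hnorm j₀
      rw [h] at this
      simp only [Complex.zero_re, Complex.zero_im] at this
      nlinarith [sq_nonneg (A j₀ * R)]
    obtain ⟨z, hzR, hz⟩ := exists_mem_ball_circleForm_pos (w := w) hR j₀ (hF j₀).nonneg hn₀ hApos
    exact Classical.epsilon_spec (p := fun T : Set ℂ => Bornology.IsBounded T ∧
      ∃ z ∈ (⋃ j, closure (𝒟 j))ᶜ, T = connectedComponentIn (⋃ j, closure (𝒟 j))ᶜ z)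
      ⟨_, Metric.isBounded_ball.subset
        (connectedComponentIn_subset_ball_of_disjoint_sphere hzR hdisj), z, hcompl ▸ hz, rfl⟩
  refine ⟨fun j => (hF j).orth R hR (he j), ?_, ?_⟩
  · obtain ⟨hbdd, z₀, -, hcomp⟩ := htri
    have hball : idealTriangle 𝒟 ⊆ Metric.ball w R := by
      rw [hcomp, hcompl] at hbdd ⊢
      exact connectedComponentIn_subset_ball hR (fun j => (hF j).nonneg) hbdd
    rintro z ⟨hz, hzq⟩
    have hzR : dist z w ≤ R :=
      closure_minimal (hball.trans Metric.ball_subset_closedBall) Metric.isClosed_closedBall hz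
    refine lt_of_le_of_ne hzR fun hzR => hzq ?_
    obtain ⟨j, rfl⟩ := hsphere z hzR fun j => by
      refine closure_minimal (fun y hy => ?_) (isClosed_le continuous_const
        (continuous_circleForm (A j) (n j) (A j * R ^ 2) w)) hz
      rw [hcomp, hcompl] at hy
      exact (connectedComponentIn_subset _ _ hy j).le
    fin_cases j <;> simp
  · rw [curv_ball w hR, (hF 0).curv_eq, (hF 1).curv_eq, (hF 2).curv_eq, kappa, eq_comm,
      Real.sqrt_eq_iff_mul_self_eq_of_pos (inv_pos.2 hR)]
    have h := hmink 0 0 1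
    simp only [mul_zero, mul_one] at h
    field_simp
    linarith

end
end

section
/- Let 𝒟=(D₁,D₂,D₃)∈TDT⁺, set α:=curv(D₁), β:=curv(D₂), γ:=curv(D₃), κ:=√(βγ+γα+αβ), let w∈W_* and write 𝒟_w=(D_{w,1},D_{w,2},D_{w,3}). Then the row vector (curv(D_{w,1}), curv(D_{w,2}), curv(D_{w,3}), κ(𝒟_w)) equals (α,β,γ,κ)·M_w, where κ(𝒟_w):=√(curv(D_{w,2})curv(D_{w,3})+curv(D_{w,3})curv(D_{w,1})+curv(D_{w,1})curv(D_{w,2})). -/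
open MeasureTheory Filter Topology Matrix
open scoped ENNReal NNReal BigOperators

namespace Descartes

/-- The Lorentzian bilinear form on the space of generalized circles
`k |p|² - 2 ⟨b, p⟩ + c = 0`, encoded as `(k, b₁, b₂, c)`. -/
def lorentz (v w : Fin 4 → ℝ) : ℝ :=
  2 * (v 1 * w 1 + v 2 * w 2) - v 0 * w 3 - v 3 * w 0

/-- The function `p ↦ k |p|² - 2 ⟨b, p⟩ + c` attached to `(k, b₁, b₂, c)`. -/
def power (v : Fin 4 → ℝ) (p : ℂ) : ℝ :=
  v 0 * (p.re ^ 2 + p.im ^ 2) - 2 * (v 1 * p.re + v 2 * p.im) + v 3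

/-- The open disk or half-plane attached to `(k, b₁, b₂, c)`. -/
def region (v : Fin 4 → ℝ) : Set ℂ := {p | power v p < 0}

/-- The null vector attached to a point of the plane. -/
def pointVec (p : ℂ) : Fin 4 → ℝ := ![1, p.re, p.im, p.re ^ 2 + p.im ^ 2]

/-- Three pairwise externally tangent generalized disks `v`, together with the generalized
disk `u` orthogonal to all of them. -/
structure IsFrame (v : Fin 3 → Fin 4 → ℝ) (u : Fin 4 → ℝ) : Prop where
  self : ∀ i, lorentz (v i) (v i) = 2
  tangent : ∀ i j, i ≠ j → lorentz (v i) (v j) = -2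
  orthogonal : ∀ i, lorentz (v i) u = 0
  self_orth : lorentz u u = 2

lemma lorentz_comm (v w : Fin 4 → ℝ) : lorentz v w = lorentz w v := by
  unfold lorentz; ring

lemma lorentz_add_left (v v' w : Fin 4 → ℝ) :
    lorentz (v + v') w = lorentz v w + lorentz v' w := by
  simp only [lorentz, Pi.add_apply]; ring

lemma lorentz_smul_left (a : ℝ) (v w : Fin 4 → ℝ) :
    lorentz (a • v) w = a * lorentz v w := by
  simp only [lorentz, Pi.smul_apply, smul_eq_mul]; ring

lemma lorentz_add_right (v w w' : Fin 4 → ℝ) :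
    lorentz v (w + w') = lorentz v w + lorentz v w' := by
  simp only [lorentz, Pi.add_apply]; ring

lemma lorentz_smul_right (a : ℝ) (v w : Fin 4 → ℝ) :
    lorentz v (a • w) = a * lorentz v w := by
  simp only [lorentz, Pi.smul_apply, smul_eq_mul]; ring

lemma power_add (v w : Fin 4 → ℝ) (p : ℂ) : power (v + w) p = power v p + power w p := by
  simp only [power, Pi.add_apply]; ring

lemma power_smul (a : ℝ) (v : Fin 4 → ℝ) (p : ℂ) : power (a • v) p = a * power v p := by
  simp only [power, Pi.smul_apply, smul_eq_mul]; ring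

lemma lorentz_pointVec (v : Fin 4 → ℝ) (p : ℂ) : lorentz (pointVec p) v = -power v p := by
  simp [lorentz, pointVec, power]; ring

lemma lorentz_pointVec_self (p : ℂ) : lorentz (pointVec p) (pointVec p) = 0 := by
  simp [lorentz, pointVec]; ring

lemma continuous_power (v : Fin 4 → ℝ) : Continuous (power v) := by
  unfold power; fun_prop

lemma power_add_smul (v : Fin 4 → ℝ) (p d : ℂ) (t : ℝ) :
    power v (p + t * d) = power v p
      + 2 * t * ((v 0 * p.re - v 1) * d.re + (v 0 * p.im - v 2) * d.im)
      + v 0 * t ^ 2 * (d.re ^ 2 + d.im ^ 2) := by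
  simp [power]; ring

/-- The form `lorentz` in terms of the gradients at a point. -/
lemma lorentz_eq_gradient (v w : Fin 4 → ℝ) (p : ℂ) :
    lorentz v w = 2 * ((v 0 * p.re - v 1) * (w 0 * p.re - w 1)
      + (v 0 * p.im - v 2) * (w 0 * p.im - w 2)) - v 0 * power w p - w 0 * power v p := by
  simp only [power, lorentz]; ring

lemma isOpen_region (v : Fin 4 → ℝ) : IsOpen (region v) :=
  isOpen_lt (continuous_power v) continuous_const

lemma isClosed_power_nonpos (v : Fin 4 → ℝ) : IsClosed {p | power v p ≤ 0} :=
  isClosed_le (continuous_power v) continuous_const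

lemma closure_region {v : Fin 4 → ℝ} (hv : lorentz v v = 2) (hk : 0 ≤ v 0) :
    closure (region v) = {p | power v p ≤ 0} := by
  apply subset_antisymm
  · exact closure_minimal (fun p (hp : power v p < 0) => show power v p ≤ 0 from hp.le) (isClosed_power_nonpos v)
  · intro p hp
    rcases lt_or_eq_of_le (show power v p ≤ 0 from hp) with h | h
    · exact subset_closure h
    set d : ℂ := ⟨-(v 0 * p.re - v 1), -(v 0 * p.im - v 2)⟩ with hd
    have hnorm : (v 0 * p.re - v 1) ^ 2 + (v 0 * p.im - v 2) ^ 2 = 1 := by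
      have := lorentz_eq_gradient v v p
      rw [h, hv] at this; linarith
    have hlim : Tendsto (fun t : ℝ => p + t * d) (𝓝[>] 0) (𝓝 p) := by
      have : Continuous (fun t : ℝ => p + t * d) := by fun_prop
      have h0 := this.tendsto 0
      simp only [Complex.ofReal_zero, zero_mul, add_zero] at h0
      exact h0.mono_left nhdsWithin_le_nhds
    refine mem_closure_of_tendsto hlim ?_
    have hmem : Set.Ioo (0 : ℝ) (1 / (v 0 + 1)) ∈ 𝓝[>] (0 : ℝ) :=
      Ioo_mem_nhdsGT (by positivity)
    filter_upwards [hmem] with t ht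
    have ht2 : t * (v 0 + 1) < 1 := by
      rw [← lt_div_iff₀ (by positivity)]; exact ht.2
    have ht1 := ht.1
    have : power v (p + t * d) = -2 * t + v 0 * t ^ 2 := by
      rw [power_add_smul, h, hd]
      linear_combination (-2 * t + v 0 * t ^ 2) * hnorm
    show power v (p + t * d) < 0
    rw [this]
    nlinarith

/-- If two generalized disks touch from outside in a single point, their vectors have
`lorentz` product `-2`. -/
lemma lorentz_eq_of_tangent {v w : Fin 4 → ℝ} (hv : lorentz v v = 2) (hw : lorentz w w = 2)
    (hv0 : 0 ≤ v 0) (hw0 : 0 ≤ w 0) {p : ℂ}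
    (h : closure (region v) ∩ closure (region w) = {p}) : lorentz v w = -2 := by
  have hdisj : Disjoint (region v) (region w) := by
    rw [Set.disjoint_iff_inter_eq_empty]
    by_contra hne
    have hne' := Set.nonempty_iff_ne_empty.mpr hne
    have hsub : region v ∩ region w ⊆ {p} :=
      h ▸ Set.inter_subset_inter subset_closure subset_closure
    have heq : region v ∩ region w = {p} := (Set.Nonempty.subset_singleton_iff hne').mp hsub
    exact not_isOpen_singleton p (heq ▸ (isOpen_region v).inter (isOpen_region w))
  have hp : p ∈ closure (region v) ∩ closure (region w) := h ▸ Set.mem_singleton p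
  have hpv := hp.1
  have hpw := hp.2
  have hnv : ¬ power v p < 0 := fun hlt =>
    Set.disjoint_left.mp (hdisj.closure_right (isOpen_region v)) hlt hpw
  have hnw : ¬ power w p < 0 := fun hlt =>
    Set.disjoint_left.mp (hdisj.closure_left (isOpen_region w)) hpv hlt
  rw [closure_region hv hv0] at hpv
  rw [closure_region hw hw0] at hpw
  have hv1 : power v p = 0 := le_antisymm hpv (not_lt.mp hnv)
  have hw1 : power w p = 0 := le_antisymm hpw (not_lt.mp hnw)
  have gv := lorentz_eq_gradient v v p
  have gw := lorentz_eq_gradient w w p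
  have gvw := lorentz_eq_gradient v w p
  rw [hv1, hv] at gv
  rw [hw1, hw] at gw
  rw [hv1, hw1] at gvw
  set a := v 0 * p.re - v 1
  set b := v 0 * p.im - v 2
  set a' := w 0 * p.re - w 1
  set b' := w 0 * p.im - w 2
  set m : ℝ := 1 + (a * a' + b * b') with hm
  have hm0 : 0 ≤ m := by nlinarith [sq_nonneg (a + a'), sq_nonneg (b + b')]
  by_contra hne
  have hmpos : 0 < m := lt_of_le_of_ne hm0 (fun h0 => hne (by linarith))
  set t : ℝ := 1 / (v 0 + w 0 + 1) with ht
  have htpos : 0 < t := by positivity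
  have htv : v 0 * t < 1 := by
    rw [ht, mul_one_div, div_lt_one (by positivity)]; linarith
  have htw : w 0 * t < 1 := by
    rw [ht, mul_one_div, div_lt_one (by positivity)]; linarith
  set d : ℂ := ⟨-(a + a'), -(b + b')⟩ with hd
  have h1 : power v (p + t * d) = -2 * t * m * (1 - v 0 * t) := by
    rw [power_add_smul, hv1]
    change 0 + 2 * t * (a * -(a + a') + b * -(b + b'))
      + v 0 * t ^ 2 * ((-(a + a')) ^ 2 + (-(b + b')) ^ 2) = _
    rw [hm]
    linear_combination (t - 1 / 2 * v 0 * t ^ 2) * gv - 1 / 2 * v 0 * t ^ 2 * gw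
  have h2 : power w (p + t * d) = -2 * t * m * (1 - w 0 * t) := by
    rw [power_add_smul, hw1]
    change 0 + 2 * t * (a' * -(a + a') + b' * -(b + b'))
      + w 0 * t ^ 2 * ((-(a + a')) ^ 2 + (-(b + b')) ^ 2) = _
    rw [hm]
    linear_combination (t - 1 / 2 * w 0 * t ^ 2) * gw - 1 / 2 * w 0 * t ^ 2 * gv
  have hmv : p + t * d ∈ region v := by
    show power v _ < 0
    rw [h1]
    nlinarith [mul_pos (mul_pos htpos hmpos) (sub_pos.mpr htv)]
  have hmw : p + t * d ∈ region w := by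
    show power w _ < 0
    rw [h2]
    nlinarith [mul_pos (mul_pos htpos hmpos) (sub_pos.mpr htw)]
  exact Set.disjoint_left.mp hdisj hmv hmw

lemma power_add_nonneg {v w : Fin 4 → ℝ} (hv : lorentz v v = 2) (hw : lorentz w w = 2)
    (hvw : lorentz v w = -2) (hk : 0 < v 0 + w 0) (p : ℂ) : 0 ≤ power v p + power w p := by
  have h := lorentz_eq_gradient (v + w) (v + w) p
  have h0 : lorentz (v + w) (v + w) = 0 := by
    rw [lorentz_add_left, lorentz_add_right, lorentz_add_right, lorentz_comm w v, hv, hw, hvw]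
    norm_num
  rw [h0, power_add] at h
  simp only [Pi.add_apply] at h
  by_contra hneg
  push Not at hneg
  nlinarith [mul_pos_of_neg_of_neg hneg (neg_neg_of_pos hk),
    sq_nonneg ((v 0 + w 0) * p.re - (v 1 + w 1)), sq_nonneg ((v 0 + w 0) * p.im - (v 2 + w 2))]

/-- Conversely, two generalized disks with `lorentz` product `-2` touch in a single point. -/
lemma tangent_of_lorentz_eq {v w : Fin 4 → ℝ} (hv : lorentz v v = 2) (hw : lorentz w w = 2)
    (hv0 : 0 ≤ v 0) (hw0 : 0 ≤ w 0) (hvw : lorentz v w = -2) (hk : 0 < v 0 + w 0) :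
    ∃ p, closure (region v) ∩ closure (region w) = {p} := by
  have h0 : lorentz (v + w) (v + w) = 0 := by
    rw [lorentz_add_left, lorentz_add_right, lorentz_add_right, lorentz_comm w v, hv, hw, hvw]
    norm_num
  refine ⟨⟨(v 1 + w 1) / (v 0 + w 0), (v 2 + w 2) / (v 0 + w 0)⟩, ?_⟩
  rw [closure_region hv hv0, closure_region hw hw0]
  have hk' := hk.ne'
  have hnull : (v 1 + w 1) ^ 2 + (v 2 + w 2) ^ 2 = (v 0 + w 0) * (v 3 + w 3) := by
    simp only [lorentz, Pi.add_apply] at h0; linarith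
  have hnull' : ((v 1 + w 1) / (v 0 + w 0)) ^ 2 + ((v 2 + w 2) / (v 0 + w 0)) ^ 2
      = (v 3 + w 3) / (v 0 + w 0) := by
    field_simp; linarith
  ext q
  simp only [Set.mem_inter_iff, Set.mem_ofPred_eq, Set.mem_singleton_iff]
  constructor
  · rintro ⟨h1, h2⟩
    have h := lorentz_eq_gradient (v + w) (v + w) q
    rw [h0, power_add] at h
    have hz : power v q + power w q = 0 :=
      le_antisymm (by linarith) (power_add_nonneg hv hw hvw hk q)
    rw [hz] at h
    simp only [Pi.add_apply] at h
    have e1 : (v 0 + w 0) * q.re - (v 1 + w 1) = 0 := by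
      nlinarith [sq_nonneg ((v 0 + w 0) * q.re - (v 1 + w 1)),
        sq_nonneg ((v 0 + w 0) * q.im - (v 2 + w 2))]
    have e2 : (v 0 + w 0) * q.im - (v 2 + w 2) = 0 := by
      nlinarith [sq_nonneg ((v 0 + w 0) * q.re - (v 1 + w 1)),
        sq_nonneg ((v 0 + w 0) * q.im - (v 2 + w 2))]
    apply Complex.ext
    · show q.re = _
      rw [eq_div_iff hk']; linarith
    · show q.im = _
      rw [eq_div_iff hk']; linarith
  · rintro rfl
    have hvs : lorentz v (v + w) = 0 := by rw [lorentz_add_right, hv, hvw]; norm_num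
    have hws : lorentz w (v + w) = 0 := by
      rw [lorentz_add_right, hw, lorentz_comm, hvw]; norm_num
    simp only [lorentz, Pi.add_apply] at hvs hws
    simp only [power]
    rw [hnull']
    constructor
    · apply le_of_eq
      field_simp
      linarith
    · apply le_of_eq
      field_simp
      linarith

lemma region_eq_ball {v : Fin 4 → ℝ} (hv : lorentz v v = 2) (hk : 0 < v 0) :
    region v = Metric.ball (⟨v 1 / v 0, v 2 / v 0⟩ : ℂ) (v 0)⁻¹ := by
  ext p
  have hsq : (p.re - v 1 / v 0) ^ 2 + (p.im - v 2 / v 0) ^ 2 - (v 0)⁻¹ ^ 2 = power v p / v 0 := by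
    simp only [lorentz] at hv
    simp only [power]
    field_simp
    linarith
  rw [Metric.mem_ball, Complex.dist_eq_re_im, Real.sqrt_lt' (by positivity)]
  change power v p < 0 ↔ (p.re - v 1 / v 0) ^ 2 + (p.im - v 2 / v 0) ^ 2 < (v 0)⁻¹ ^ 2
  rw [← sub_neg (b := (v 0)⁻¹ ^ 2), hsq, div_neg_iff]
  constructor
  · intro h; exact Or.inr ⟨h, hk⟩
  · rintro (h | h)
    · linarith [h.2]
    · exact h.1

lemma isOpenDisk_region {v : Fin 4 → ℝ} (hv : lorentz v v = 2) (hk : 0 < v 0) :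
    IsOpenDisk (region v) :=
  ⟨_, _, inv_pos.mpr hk, region_eq_ball hv hk⟩

lemma diskRadius_ball (z : ℂ) {r : ℝ} (hr : 0 < r) : diskRadius (Metric.ball z r) = r := by
  have h : 0 < diskRadius (Metric.ball z r) ∧
      ∃ z', Metric.ball z r = Metric.ball z' (diskRadius (Metric.ball z r)) :=
    Classical.epsilon_spec (p := fun s : ℝ => 0 < s ∧ ∃ z' : ℂ, Metric.ball z r = Metric.ball z' s)
      ⟨r, hr, z, rfl⟩
  obtain ⟨hs, z', h⟩ := h
  have h2 := Metric.diam_ball_eq z hr.le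
  rw [h, Metric.diam_ball_eq z' hs.le] at h2
  linarith

lemma curv_region {v : Fin 4 → ℝ} (hv : lorentz v v = 2) (hk : 0 ≤ v 0) :
    curv (region v) = v 0 := by
  rcases hk.lt_or_eq with hk | hk
  · rw [curv, if_pos (isOpenDisk_region hv hk), region_eq_ball hv hk,
      diskRadius_ball _ (inv_pos.mpr hk), inv_inv]
  · rw [curv, if_neg, hk]
    rintro ⟨z, r, hr, h⟩
    have hb : v 1 ^ 2 + v 2 ^ 2 = 1 := by
      simp only [lorentz, ← hk] at hv; linarith
    have hpow : ∀ t : ℝ, power v (t * ⟨v 1, v 2⟩) = -2 * t + v 3 := by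
      intro t
      simp [power, ← hk]
      linear_combination t * hb
    have hmem : ∀ t : ℝ, v 3 / 2 < t → ‖(t * ⟨v 1, v 2⟩ : ℂ) - z‖ < r := by
      intro t ht
      rw [← dist_eq_norm, ← Metric.mem_ball, ← h]
      show power v _ < 0
      rw [hpow]; linarith
    have h1 := hmem (v 3 / 2 + 1) (by linarith)
    have h2 := hmem (v 3 / 2 + 1 + 2 * r) (by linarith)
    have hn : ‖(⟨v 1, v 2⟩ : ℂ)‖ = 1 := by
      rw [Complex.norm_eq_sqrt_sq_add_sq]; simp [hb]
    have h3 := norm_sub_le (((v 3 / 2 + 1 + 2 * r : ℝ) : ℂ) * ⟨v 1, v 2⟩ - z)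
      (((v 3 / 2 + 1 : ℝ) : ℂ) * ⟨v 1, v 2⟩ - z)
    have h4 : (((v 3 / 2 + 1 + 2 * r : ℝ) : ℂ) * ⟨v 1, v 2⟩ - z)
      - (((v 3 / 2 + 1 : ℝ) : ℂ) * ⟨v 1, v 2⟩ - z) = ((2 * r : ℝ) : ℂ) * ⟨v 1, v 2⟩ := by
      push_cast; ring
    rw [h4, norm_mul, hn, Complex.norm_real, Real.norm_of_nonneg (by linarith)] at h3
    linarith

lemma exists_region_of_isOpenDisk {D : Set ℂ} (hD : IsOpenDisk D) :
    ∃ v, lorentz v v = 2 ∧ 0 < v 0 ∧ D = region v := by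
  obtain ⟨z, r, hr, rfl⟩ := hD
  have hv : lorentz ![r⁻¹, z.re / r, z.im / r, (z.re ^ 2 + z.im ^ 2 - r ^ 2) / r]
      ![r⁻¹, z.re / r, z.im / r, (z.re ^ 2 + z.im ^ 2 - r ^ 2) / r] = 2 := by
    simp [lorentz]; field_simp; ring
  refine ⟨_, hv, by simpa using hr, ?_⟩
  rw [region_eq_ball hv (by simpa using hr)]
  simp [hr.ne']

lemma exists_region_of_isOpenHalfPlane {D : Set ℂ} (hD : IsOpenHalfPlane D) :
    ∃ v, lorentz v v = 2 ∧ v 0 = 0 ∧ D = region v := by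
  obtain ⟨a, ha, c, rfl⟩ := hD
  have hn : 0 < ‖a‖ := norm_pos_iff.mpr ha
  have hsq : a.re ^ 2 + a.im ^ 2 = ‖a‖ ^ 2 := by
    rw [Complex.sq_norm, Complex.normSq_apply]; ring
  refine ⟨![0, -a.re / ‖a‖, a.im / ‖a‖, -2 * c / ‖a‖], ?_, by simp, ?_⟩
  · simp [lorentz]
    field_simp
    linarith
  · ext p
    have : power ![0, -a.re / ‖a‖, a.im / ‖a‖, -2 * c / ‖a‖] p
        = 2 * ((a * p).re - c) / ‖a‖ := by
      simp [power]; field_simp; ring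
    show (a * p).re < c ↔ power _ p < 0
    rw [this, div_neg_iff]
    constructor
    · intro h; exact Or.inr ⟨by linarith, hn⟩
    · rintro (h | h)
      · linarith [h.2]
      · linarith [h.1]

/-- A null vector with nonzero leading coordinate is a multiple of the vector of a point. -/
lemma power_of_null {X : Fin 4 → ℝ} (hX : lorentz X X = 0) (h0 : X 0 ≠ 0) (v : Fin 4 → ℝ) :
    power v ⟨X 1 / X 0, X 2 / X 0⟩ = -lorentz X v / X 0 := by
  have h : (X 1 / X 0) ^ 2 + (X 2 / X 0) ^ 2 = X 3 / X 0 := by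
    simp only [lorentz] at hX
    field_simp
    linarith
  simp only [power, lorentz]
  rw [h]
  field_simp
  ring

namespace IsFrame

variable {v : Fin 3 → Fin 4 → ℝ} {u : Fin 4 → ℝ}

/-- The expansion of a vector in the basis given by a frame. -/
lemma expand (h : IsFrame v u) (X : Fin 4 → ℝ) :
    X = (-(lorentz X (v 1) + lorentz X (v 2)) / 4) • v 0
      + (-(lorentz X (v 0) + lorentz X (v 2)) / 4) • v 1
      + (-(lorentz X (v 0) + lorentz X (v 1)) / 4) • v 2
      + (lorentz X u / 2) • u := by
  have s0 := h.self 0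
  have s1 := h.self 1
  have s2 := h.self 2
  have t01 := h.tangent 0 1 (by decide)
  have t02 := h.tangent 0 2 (by decide)
  have t12 := h.tangent 1 2 (by decide)
  have o0 := h.orthogonal 0
  have o1 := h.orthogonal 1
  have o2 := h.orthogonal 2
  have su := h.self_orth
  let R : Fin 4 → Fin 4 → ℝ := ![v 0, v 1, v 2, u]
  let V : Matrix (Fin 4) (Fin 4) ℝ := Matrix.of R
  let W : Fin 4 → Fin 4 → ℝ := ![(-1 / 4 : ℝ) • (v 1 + v 2), (-1 / 4 : ℝ) • (v 0 + v 2),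
    (-1 / 4 : ℝ) • (v 0 + v 1), (1 / 2 : ℝ) • u]
  let B : Matrix (Fin 4) (Fin 4) ℝ :=
    Matrix.of ![fun m => -W m 3, fun m => 2 * W m 1, fun m => 2 * W m 2, fun m => -W m 0]
  have hlor : ∀ Y m, ∑ i, Y i * B i m = lorentz Y (W m) := by
    intro Y m
    simp [Fin.sum_univ_four, B, lorentz]
    ring
  have hVB : V * B = 1 := by
    ext k m
    rw [Matrix.mul_apply]
    change ∑ i, R k i * B i m = _
    rw [hlor]
    fin_cases k <;> fin_cases m <;>
      simp [R, W, lorentz_smul_right, lorentz_add_right, s0, s1, s2, t01, t02, t12, o0, o1, o2, su,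
        lorentz_comm (v 1) (v 0), lorentz_comm (v 2) (v 0), lorentz_comm (v 2) (v 1),
        lorentz_comm u (v _)] <;> norm_num
  have hBV : B * V = 1 := mul_eq_one_comm.mp hVB
  have hX : X = X ᵥ* B ᵥ* V := by rw [Matrix.vecMul_vecMul, hBV, Matrix.vecMul_one]
  have hc : ∀ m, (X ᵥ* B) m = lorentz X (W m) := fun m => hlor X m
  ext j
  conv_lhs => rw [hX]
  have hj : (X ᵥ* B ᵥ* V) j = ∑ m, lorentz X (W m) * R m j := by
    rw [funext hc]; rfl
  rw [hj, Fin.sum_univ_four]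
  simp [R, W, lorentz_smul_right, lorentz_add_right]
  ring

lemma sq_lorentz_orth (h : IsFrame v u) {X : Fin 4 → ℝ} (hX : lorentz X X = 0) :
    lorentz X u ^ 2 = lorentz X (v 1) * lorentz X (v 2) + lorentz X (v 2) * lorentz X (v 0)
      + lorentz X (v 0) * lorentz X (v 1) := by
  have h1 := congrArg (lorentz X) (h.expand X)
  simp only [lorentz_add_right, lorentz_smul_right] at h1
  linear_combination (-2) * h1 + 2 * hX

lemma sq_curv_orth (h : IsFrame v u) :
    u 0 ^ 2 = v 1 0 * v 2 0 + v 2 0 * v 0 0 + v 0 0 * v 1 0 := by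
  have h1 := h.sq_lorentz_orth (X := ![0, 0, 0, 1]) (by simp [lorentz])
  simpa [lorentz] using h1

lemma sq_power_orth (h : IsFrame v u) (p : ℂ) :
    power u p ^ 2 = power (v 1) p * power (v 2) p + power (v 2) p * power (v 0) p
      + power (v 0) p * power (v 1) p := by
  have h1 := h.sq_lorentz_orth (lorentz_pointVec_self p)
  simpa [lorentz_pointVec] using h1

end IsFrame

/-- The region bounded by the three generalized disks `v` inside their orthogonal disk `u`. -/
def triangle (v : Fin 3 → Fin 4 → ℝ) (u : Fin 4 → ℝ) : Set ℂ :=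
  {p | power u p < 0 ∧ ∀ i, 0 < power (v i) p}

/-- The region outside of the three generalized disks `v` and of their orthogonal disk `u`. -/
def outside (v : Fin 3 → Fin 4 → ℝ) (u : Fin 4 → ℝ) : Set ℂ :=
  {p | 0 < power u p ∧ ∀ i, 0 < power (v i) p}

/-- A null vector with prescribed products with the members of a frame. -/
noncomputable def nullVec (v : Fin 3 → Fin 4 → ℝ) (u : Fin 4 → ℝ) (x : Fin 3 → ℝ) : Fin 4 → ℝ :=
  ((x 1 + x 2) / 4) • v 0 + ((x 0 + x 2) / 4) • v 1 + ((x 0 + x 1) / 4) • v 2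
    + (√(x 1 * x 2 + x 2 * x 0 + x 0 * x 1) / 2) • u

/-- A frame of disks and half-planes realizing the triple `𝒟`. -/
structure IsRealization (𝒟 : Fin 3 → Set ℂ) (v : Fin 3 → Fin 4 → ℝ) (u : Fin 4 → ℝ) : Prop
    extends IsFrame v u where
  nonneg : ∀ i, 0 ≤ v i 0
  pos : 0 < u 0
  eq_region : ∀ i, 𝒟 i = region (v i)

namespace IsRealization

variable {𝒟 : Fin 3 → Set ℂ} {v : Fin 3 → Fin 4 → ℝ} {u : Fin 4 → ℝ}

lemma nullVec_spec (h : IsRealization 𝒟 v u) {x : Fin 3 → ℝ} (hx : ∀ i, 0 < x i) :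
    lorentz (nullVec v u x) (nullVec v u x) = 0 ∧ 0 < nullVec v u x 0 ∧
      (∀ i, lorentz (nullVec v u x) (v i) = -x i) ∧ 0 < lorentz (nullVec v u x) u := by
  have s0 := h.self 0
  have s1 := h.self 1
  have s2 := h.self 2
  have t01 := h.tangent 0 1 (by decide)
  have t02 := h.tangent 0 2 (by decide)
  have t12 := h.tangent 1 2 (by decide)
  have t10 := h.tangent 1 0 (by decide)
  have t20 := h.tangent 2 0 (by decide)
  have t21 := h.tangent 2 1 (by decide)
  have o0 := h.orthogonal 0
  have o1 := h.orthogonal 1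
  have o2 := h.orthogonal 2
  have su := h.self_orth
  have x0 := hx 0
  have x1 := hx 1
  have x2 := hx 2
  have hσ : 0 < x 1 * x 2 + x 2 * x 0 + x 0 * x 1 := by positivity
  have hsq := Real.sq_sqrt hσ.le
  have hpos := Real.sqrt_pos.mpr hσ
  have hv : ∀ i, lorentz (nullVec v u x) (v i) = -x i := by
    intro i
    fin_cases i <;>
      simp [nullVec, lorentz_add_left, lorentz_smul_left, s0, s1, s2, t01, t02, t12, t10, t20, t21,
        o0, o1, o2, lorentz_comm u] <;> ring
  have hu : lorentz (nullVec v u x) u = √(x 1 * x 2 + x 2 * x 0 + x 0 * x 1) := by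
    simp [nullVec, lorentz_add_left, lorentz_smul_left, o0, o1, o2, su]
  refine ⟨?_, ?_, hv, hu ▸ hpos⟩
  · conv_lhs => arg 2; rw [nullVec]
    simp only [lorentz_add_right, lorentz_smul_right, hv, hu]
    linear_combination hsq / 2
  · have k0 := h.nonneg 0
    have k1 := h.nonneg 1
    have k2 := h.nonneg 2
    have ku := h.pos
    simp only [nullVec, Pi.add_apply, Pi.smul_apply, smul_eq_mul]
    positivity

lemma isPreconnected_triangle (h : IsRealization 𝒟 v u) : IsPreconnected (triangle v u) := by
  have himage : triangle v u = (fun x : Fin 3 → ℝ =>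
      (⟨nullVec v u x 1 / nullVec v u x 0, nullVec v u x 2 / nullVec v u x 0⟩ : ℂ)) ''
      (Set.univ.pi fun _ => Set.Ioi 0) := by
    ext p
    constructor
    · rintro ⟨hu, hv⟩
      refine ⟨fun i => power (v i) p, fun i _ => hv i, ?_⟩
      have hp : nullVec v u (fun i => power (v i) p) = pointVec p := by
        rw [h.expand (pointVec p), nullVec]
        have hsqrt : √(power (v 1) p * power (v 2) p + power (v 2) p * power (v 0) p
            + power (v 0) p * power (v 1) p) = -power u p := by
          rw [← h.sq_power_orth p, Real.sqrt_sq_eq_abs, abs_of_neg hu]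
        simp only [lorentz_pointVec, hsqrt]
        congr 4 <;> ring
      simp [hp, pointVec]
    · rintro ⟨x, hx, rfl⟩
      have hx' : ∀ i, 0 < x i := fun i => hx i trivial
      obtain ⟨h0, hk, hv, hu⟩ := h.nullVec_spec hx'
      refine ⟨?_, fun i => ?_⟩
      · rw [power_of_null h0 hk.ne']
        exact div_neg_of_neg_of_pos (neg_neg_of_pos hu) hk
      · rw [power_of_null h0 hk.ne', hv, neg_neg]
        exact div_pos (hx' i) hk
  rw [himage]
  refine (convex_pi fun i _ => convex_Ioi (0 : ℝ)).isPreconnected.image _ ?_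
  have hcont : Continuous (nullVec v u) := by unfold nullVec; fun_prop
  have hc : ∀ i, ContinuousOn (fun x => nullVec v u x i) (Set.univ.pi fun _ => Set.Ioi 0) :=
    fun i => ((continuous_apply i).comp hcont).continuousOn
  have hne : ∀ x ∈ Set.univ.pi (fun _ : Fin 3 => Set.Ioi (0 : ℝ)), nullVec v u x 0 ≠ 0 :=
    fun x hx => (h.nullVec_spec fun i => hx i trivial).2.1.ne'
  exact Complex.equivRealProdCLM.symm.continuous.comp_continuousOn
    (((hc 1).div (hc 0) hne).prodMk ((hc 2).div (hc 0) hne))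

lemma isOpen_triangle (v : Fin 3 → Fin 4 → ℝ) (u : Fin 4 → ℝ) : IsOpen (triangle v u) := by
  have h : triangle v u = {p | power u p < 0} ∩ ⋂ i, {p | 0 < power (v i) p} := by
    ext p; simp [triangle]
  rw [h]
  exact (isOpen_lt (continuous_power u) continuous_const).inter
    (isOpen_iInter_of_finite fun i => isOpen_lt continuous_const (continuous_power (v i)))

lemma isOpen_outside (v : Fin 3 → Fin 4 → ℝ) (u : Fin 4 → ℝ) : IsOpen (outside v u) := by
  have h : outside v u = {p | 0 < power u p} ∩ ⋂ i, {p | 0 < power (v i) p} := by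
    ext p; simp [outside]
  rw [h]
  exact (isOpen_lt continuous_const (continuous_power u)).inter
    (isOpen_iInter_of_finite fun i => isOpen_lt continuous_const (continuous_power (v i)))

lemma disjoint_triangle_outside (v : Fin 3 → Fin 4 → ℝ) (u : Fin 4 → ℝ) :
    Disjoint (triangle v u) (outside v u) :=
  Set.disjoint_left.mpr fun _ h1 h2 => lt_asymm h1.1 h2.1

lemma compl_closure_eq (h : IsRealization 𝒟 v u) :
    (⋃ j, closure (𝒟 j))ᶜ = {p | ∀ i, 0 < power (v i) p} := by
  ext p
  simp only [h.eq_region, fun j => closure_region (h.self j) (h.nonneg j)]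
  simp

lemma compl_closure_eq_union (h : IsRealization 𝒟 v u) :
    (⋃ j, closure (𝒟 j))ᶜ = triangle v u ∪ outside v u := by
  rw [h.compl_closure_eq]
  ext p
  constructor
  · intro hp
    have h2 := h.sq_power_orth p
    have h3 : power u p ≠ 0 := by
      intro h0
      have p0 := hp 0
      have p1 := hp 1
      have p2 := hp 2
      have : 0 < power (v 1) p * power (v 2) p + power (v 2) p * power (v 0) p
        + power (v 0) p * power (v 1) p := by positivity
      rw [← h2, h0] at this
      norm_num at this
    exact (lt_or_gt_of_ne h3).imp (fun h => ⟨h, hp⟩) (fun h => ⟨h, hp⟩)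
  · rintro (hp | hp)
    · exact hp.2
    · exact hp.2

/-- A point outside of the orthogonal disk can escape to infinity along a ray. -/
lemma not_isBounded_component (h : IsRealization 𝒟 v u) {z : ℂ} (hz : z ∈ outside v u) :
    ¬ Bornology.IsBounded (connectedComponentIn (⋃ j, closure (𝒟 j))ᶜ z) := by
  set d : ℂ := ⟨u 0 * z.re - u 1, u 0 * z.im - u 2⟩ with hd
  have hd1 : 1 ≤ d.re ^ 2 + d.im ^ 2 := by
    have := lorentz_eq_gradient u u z
    rw [h.self_orth] at this
    nlinarith [mul_pos h.pos hz.1]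
  have hray : ∀ t : ℝ, 0 ≤ t → z + t * d ∈ (⋃ j, closure (𝒟 j))ᶜ := by
    intro t ht
    rw [h.compl_closure_eq]
    intro i
    rw [power_add_smul]
    have h1 := lorentz_eq_gradient (v i) u z
    rw [h.orthogonal i] at h1
    have h2 := hz.2 i
    have h3 : 0 ≤ (v i 0 * z.re - v i 1) * d.re + (v i 0 * z.im - v i 2) * d.im := by
      have := mul_nonneg (h.nonneg i) hz.1.le
      have := mul_nonneg h.pos.le h2.le
      simp only [hd]
      linarith
    have := h.nonneg i
    positivity
  have hconn : IsPreconnected ((fun t : ℝ => z + t * d) '' Set.Ici 0) :=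
    (convex_Ici (0 : ℝ)).isPreconnected.image _ (by fun_prop)
  have hsub := hconn.subset_connectedComponentIn (x := z) (F := (⋃ j, closure (𝒟 j))ᶜ)
    ⟨0, Set.self_mem_Ici, by simp⟩ (by rintro _ ⟨t, ht, rfl⟩; exact hray t ht)
  intro hb
  obtain ⟨R, hR⟩ := (Metric.isBounded_iff_subset_closedBall z).mp (hb.subset hsub)
  have hmem := hR ⟨|R| + 1, show (0 : ℝ) ≤ |R| + 1 by positivity, rfl⟩
  simp only [Metric.mem_closedBall, dist_eq_norm, add_sub_cancel_left, norm_mul,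
    Complex.norm_real] at hmem
  rw [Real.norm_of_nonneg (by positivity)] at hmem
  have hnd : 1 ≤ ‖d‖ := by
    rw [Complex.norm_eq_sqrt_sq_add_sq]; exact Real.one_le_sqrt.mpr hd1
  nlinarith [le_abs_self R, abs_nonneg R]

/-- The vector of the inscribed disk. -/
def inscribed (v : Fin 3 → Fin 4 → ℝ) (u : Fin 4 → ℝ) : Fin 4 → ℝ :=
  v 0 + v 1 + v 2 + (2 : ℝ) • u

lemma lorentz_sum (h : IsFrame v u) (i : Fin 3) : lorentz (v 0 + v 1 + v 2) (v i) = -2 := by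
  have s0 := h.self 0
  have s1 := h.self 1
  have s2 := h.self 2
  have t01 := h.tangent 0 1 (by decide)
  have t02 := h.tangent 0 2 (by decide)
  have t12 := h.tangent 1 2 (by decide)
  have t10 := h.tangent 1 0 (by decide)
  have t20 := h.tangent 2 0 (by decide)
  have t21 := h.tangent 2 1 (by decide)
  fin_cases i <;> simp [lorentz_add_left, s0, s1, s2, t01, t02, t12, t10, t20, t21]

lemma lorentz_sum_orth (h : IsFrame v u) : lorentz (v 0 + v 1 + v 2) u = 0 := by
  simp [lorentz_add_left, h.orthogonal]

lemma lorentz_sum_self (h : IsFrame v u) :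
    lorentz (v 0 + v 1 + v 2) (v 0 + v 1 + v 2) = -6 := by
  rw [lorentz_add_right, lorentz_add_right, lorentz_sum h, lorentz_sum h, lorentz_sum h]
  norm_num

lemma lorentz_inscribed (h : IsFrame v u) (i : Fin 3) : lorentz (inscribed v u) (v i) = -2 := by
  rw [inscribed, lorentz_add_left, lorentz_sum h, lorentz_smul_left, lorentz_comm, h.orthogonal]
  norm_num

lemma lorentz_inscribed_orth (h : IsFrame v u) : lorentz (inscribed v u) u = 4 := by
  rw [inscribed, lorentz_add_left, lorentz_sum_orth h, lorentz_smul_left, h.self_orth]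
  norm_num

lemma lorentz_inscribed_sum (h : IsFrame v u) :
    lorentz (inscribed v u) (v 0 + v 1 + v 2) = -6 := by
  rw [lorentz_add_right, lorentz_add_right, lorentz_inscribed h, lorentz_inscribed h,
    lorentz_inscribed h]
  norm_num

lemma lorentz_inscribed_self (h : IsFrame v u) :
    lorentz (inscribed v u) (inscribed v u) = 2 := by
  conv_lhs => arg 2; rw [inscribed]
  rw [lorentz_add_right, lorentz_smul_right, lorentz_inscribed_sum h, lorentz_inscribed_orth h]
  norm_num

lemma inscribed_pos (h : IsRealization 𝒟 v u) : 0 < inscribed v u 0 := by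
  have k0 := h.nonneg 0
  have k1 := h.nonneg 1
  have k2 := h.nonneg 2
  have ku := h.pos
  simp only [inscribed, Pi.add_apply, Pi.smul_apply, smul_eq_mul]
  positivity

lemma power_inscribed (v : Fin 3 → Fin 4 → ℝ) (u : Fin 4 → ℝ) (p : ℂ) :
    power (inscribed v u) p = power (v 0) p + power (v 1) p + power (v 2) p + 2 * power u p := by
  simp only [inscribed, power_add, power_smul]

lemma region_inscribed_subset (h : IsRealization 𝒟 v u) :
    region (inscribed v u) ⊆ triangle v u := by
  intro p (hp : power _ p < 0)
  have hi : ∀ i, 0 < power (v i) p := by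
    intro i
    have := power_add_nonneg (lorentz_inscribed_self h.toIsFrame) (h.self i)
      (lorentz_inscribed h.toIsFrame i) (add_pos_of_pos_of_nonneg h.inscribed_pos (h.nonneg i)) p
    linarith
  refine ⟨?_, hi⟩
  rw [power_inscribed] at hp
  linarith [hi 0, hi 1, hi 2]

lemma nonempty_region {w : Fin 4 → ℝ} (hw : lorentz w w = 2) (hk : 0 < w 0) :
    (region w).Nonempty := by
  rw [region_eq_ball hw hk]
  exact Metric.nonempty_ball.mpr (inv_pos.mpr hk)

lemma connectedComponentIn_eq_triangle (h : IsRealization 𝒟 v u) {z : ℂ}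
    (hz : z ∈ triangle v u) :
    connectedComponentIn (⋃ j, closure (𝒟 j))ᶜ z = triangle v u := by
  have hsub : triangle v u ⊆ (⋃ j, closure (𝒟 j))ᶜ := by
    rw [h.compl_closure_eq_union]; exact Set.subset_union_left
  apply subset_antisymm
  · refine isPreconnected_connectedComponentIn.subset_left_of_subset_union
      (isOpen_triangle v u) (isOpen_outside v u) (disjoint_triangle_outside v u) ?_
      ⟨z, mem_connectedComponentIn (hsub hz), hz⟩
    rw [← h.compl_closure_eq_union]
    exact connectedComponentIn_subset _ _
  · exact h.isPreconnected_triangle.subset_connectedComponentIn hz hsub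

lemma idealTriangle_eq (h : IsRealization 𝒟 v u) : idealTriangle 𝒟 = triangle v u := by
  obtain ⟨z, hz⟩ := (nonempty_region (lorentz_inscribed_self h.toIsFrame) h.inscribed_pos).mono
    h.region_inscribed_subset
  have hbdd : Bornology.IsBounded (triangle v u) := by
    refine Bornology.IsBounded.subset ?_ (show triangle v u ⊆ region u from fun p hp => hp.1)
    rw [region_eq_ball h.self_orth h.pos]
    exact Metric.isBounded_ball
  have hz' : z ∈ (⋃ j, closure (𝒟 j))ᶜ := by
    rw [h.compl_closure_eq_union]; exact Or.inl hz
  have hspec : Bornology.IsBounded (idealTriangle 𝒟) ∧ ∃ z ∈ (⋃ j, closure (𝒟 j))ᶜ,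
      idealTriangle 𝒟 = connectedComponentIn (⋃ j, closure (𝒟 j))ᶜ z :=
    Classical.epsilon_spec (p := fun T : Set ℂ => Bornology.IsBounded T ∧
      ∃ z ∈ (⋃ j, closure (𝒟 j))ᶜ, T = connectedComponentIn (⋃ j, closure (𝒟 j))ᶜ z)
      ⟨triangle v u, hbdd, z, hz', (h.connectedComponentIn_eq_triangle hz).symm⟩
  obtain ⟨hb, y, hy, heq⟩ := hspec
  rw [h.compl_closure_eq_union] at hy
  rcases hy with hy | hy
  · rw [heq, h.connectedComponentIn_eq_triangle hy]
  · exact absurd (heq ▸ hb) (h.not_isBounded_component hy)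

lemma isInscribedDisk_region (h : IsRealization 𝒟 v u) :
    IsInscribedDisk 𝒟 (region (inscribed v u)) := by
  refine ⟨isOpenDisk_region (lorentz_inscribed_self h.toIsFrame) h.inscribed_pos,
    h.idealTriangle_eq ▸ h.region_inscribed_subset, fun j => ?_⟩
  rw [h.eq_region j]
  exact tangent_of_lorentz_eq (lorentz_inscribed_self h.toIsFrame) (h.self j) h.inscribed_pos.le
    (h.nonneg j) (lorentz_inscribed h.toIsFrame j)
    (add_pos_of_pos_of_nonneg h.inscribed_pos (h.nonneg j))

lemma eq_region_inscribed (h : IsRealization 𝒟 v u) {D : Set ℂ} (hD : IsInscribedDisk 𝒟 D) :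
    D = region (inscribed v u) := by
  obtain ⟨hdisk, hsub, htan⟩ := hD
  obtain ⟨w, hw, hk, rfl⟩ := exists_region_of_isOpenDisk hdisk
  rw [h.idealTriangle_eq] at hsub
  have hwv : ∀ i, lorentz w (v i) = -2 := by
    intro i
    obtain ⟨p, hp⟩ := htan i
    rw [h.eq_region i] at hp
    exact lorentz_eq_of_tangent hw (h.self i) hk.le (h.nonneg i) hp
  have hexp := h.expand w
  have h1 := congrArg (lorentz w) hexp
  simp only [lorentz_add_right, lorentz_smul_right, hwv, hw] at h1
  have h2 : (lorentz w u - 4) * (lorentz w u + 4) = 0 := by linear_combination (-2) * h1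
  simp only [hwv] at hexp
  rcases mul_eq_zero.mp h2 with h3 | h3
  · have h4 : lorentz w u = 4 := by linarith
    rw [h4] at hexp
    rw [hexp, inscribed]
    norm_num
  · exfalso
    have h4 : lorentz w u = -4 := by linarith
    rw [h4] at hexp
    obtain ⟨p, hp⟩ := nonempty_region hw hk
    obtain ⟨hu, hv⟩ := hsub hp
    have hp' : power w p < 0 := hp
    rw [hexp] at hp'
    simp only [power_add, power_smul] at hp'
    linarith [hv 0, hv 1, hv 2]

lemma Din_eq (h : IsRealization 𝒟 v u) : Din 𝒟 = region (inscribed v u) :=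
  h.eq_region_inscribed (Classical.epsilon_spec (p := IsInscribedDisk 𝒟)
    ⟨_, h.isInscribedDisk_region⟩)

lemma phi (h : IsRealization 𝒟 v u) (j : Fin 3) :
    IsRealization (Phi j 𝒟) (Function.update v j (inscribed v u))
      (u + (v 0 + v 1 + v 2) + (-1 : ℝ) • v j) := by
  have hF := h.toIsFrame
  have hvu : ∀ i, i ≠ j → lorentz (v i) (u + (v 0 + v 1 + v 2) + (-1 : ℝ) • v j) = 0 := by
    intro i hij
    rw [lorentz_add_right, lorentz_add_right, lorentz_smul_right, hF.orthogonal,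
      lorentz_comm (v i) (v 0 + v 1 + v 2), lorentz_sum hF, hF.tangent i j hij]
    norm_num
  refine { self := ?_, tangent := ?_, orthogonal := ?_, self_orth := ?_, nonneg := ?_,
           pos := ?_, eq_region := ?_ }
  · intro i
    rcases eq_or_ne i j with rfl | hij
    · rw [Function.update_self, lorentz_inscribed_self hF]
    · rw [Function.update_of_ne hij, hF.self]
  · intro i l hil
    rcases eq_or_ne i j with rfl | hij
    · rw [Function.update_self, Function.update_of_ne hil.symm, lorentz_inscribed hF]
    · rcases eq_or_ne l j with rfl | hlj
      · rw [Function.update_self, Function.update_of_ne hij, lorentz_comm, lorentz_inscribed hF]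
      · rw [Function.update_of_ne hlj, Function.update_of_ne hij, hF.tangent i l hil]
  · intro i
    rcases eq_or_ne i j with rfl | hij
    · rw [Function.update_self, lorentz_add_right, lorentz_add_right, lorentz_smul_right,
        lorentz_inscribed_orth hF, lorentz_inscribed_sum hF, lorentz_inscribed hF]
      norm_num
    · rw [Function.update_of_ne hij, hvu i hij]
  · rw [lorentz_add_left, lorentz_add_left, lorentz_smul_left]
    simp only [lorentz_add_right u, lorentz_add_right _ _ ((-1 : ℝ) • v j),
      lorentz_add_right _ u, lorentz_smul_right, lorentz_comm u (v _), lorentz_comm (v j) (_ + _),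
      lorentz_sum hF, lorentz_sum_orth hF, lorentz_sum_self hF,
      hF.orthogonal, hF.self, hF.self_orth]
    norm_num
  · intro i
    rcases eq_or_ne i j with rfl | hij
    · rw [Function.update_self]; exact h.inscribed_pos.le
    · rw [Function.update_of_ne hij]; exact h.nonneg i
  · have k0 := h.nonneg 0
    have k1 := h.nonneg 1
    have k2 := h.nonneg 2
    have ku := h.pos
    simp only [Pi.add_apply, Pi.smul_apply, smul_eq_mul]
    fin_cases j <;> simp <;> linarith
  · intro i
    rcases eq_or_ne i j with rfl | hij
    · rw [Phi, Function.update_self, Function.update_self, h.Din_eq]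
    · rw [Phi, Function.update_of_ne hij, Function.update_of_ne hij, h.eq_region]

lemma curvVec_eq (h : IsRealization 𝒟 v u) : curvVec 𝒟 = ![v 0 0, v 1 0, v 2 0, u 0] := by
  have hc : ∀ i, curv (𝒟 i) = v i 0 := fun i => by
    rw [h.eq_region, curv_region (h.self i) (h.nonneg i)]
  rw [curvVec, hc, hc, hc, kappa, ← h.sq_curv_orth, Real.sqrt_sq h.pos.le]

lemma curvVec_phi (h : IsRealization 𝒟 v u) (j : Fin 3) :
    curvVec (Phi j 𝒟) = curvVec 𝒟 ᵥ* Mmat j := by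
  rw [(h.phi j).curvVec_eq, h.curvVec_eq]
  ext i
  fin_cases j <;> fin_cases i <;>
    simp [Mmat, inscribed, Matrix.vecMul, dotProduct, Fin.sum_univ_four] <;> ring

lemma curvVec_word (h : IsRealization 𝒟 v u) (w : Word) :
    curvVec (applyWord 𝒟 w) = curvVec 𝒟 ᵥ* Mword w := by
  induction w generalizing 𝒟 v u with
  | nil => simp [applyWord, Mword]
  | cons j w ih =>
    have hw : applyWord 𝒟 (j :: w) = applyWord (Phi j 𝒟) w := rfl
    rw [hw, ih (h.phi j), h.curvVec_phi, Matrix.vecMul_vecMul, Mword, Mword, List.map_cons,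
      List.prod_cons]

end IsRealization

/-- The orthogonal vector of three vectors, up to normalization. -/
noncomputable def cross (a b c : Fin 4 → ℝ) : Fin 4 → ℝ :=
  let m (i j k : Fin 4) : ℝ := a i * (b j * c k - b k * c j) - a j * (b i * c k - b k * c i)
    + a k * (b i * c j - b j * c i)
  ![m 0 1 2, -m 0 2 3 / 2, m 0 1 3 / 2, -m 1 2 3]

lemma lorentz_cross_self (a b c : Fin 4 → ℝ) :
    lorentz (cross a b c) (cross a b c) =
      -(lorentz a a * (lorentz b b * lorentz c c - lorentz b c ^ 2)
        - lorentz a b * (lorentz a b * lorentz c c - lorentz b c * lorentz a c)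
        + lorentz a c * (lorentz a b * lorentz b c - lorentz b b * lorentz a c)) / 4 := by
  simp [lorentz, cross]
  ring

lemma exists_isFrame {v : Fin 3 → Fin 4 → ℝ} (hs : ∀ i, lorentz (v i) (v i) = 2)
    (ht : ∀ i j, i ≠ j → lorentz (v i) (v j) = -2) : ∃ u, IsFrame v u := by
  refine ⟨(1 / 2 : ℝ) • cross (v 0) (v 1) (v 2), hs, ht, ?_, ?_⟩
  · intro i
    rw [lorentz_smul_right]
    fin_cases i <;> simp [lorentz, cross] <;> ring
  · rw [lorentz_smul_right, lorentz_smul_left, lorentz_cross_self, hs, hs, hs, ht 0 1 (by decide),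
      ht 0 2 (by decide), ht 1 2 (by decide)]
    norm_num

lemma IsFrame.neg {v : Fin 3 → Fin 4 → ℝ} {u : Fin 4 → ℝ} (h : IsFrame v u) :
    IsFrame v ((-1 : ℝ) • u) where
  self := h.self
  tangent := h.tangent
  orthogonal i := by rw [lorentz_smul_right, h.orthogonal, mul_zero]
  self_orth := by rw [lorentz_smul_right, lorentz_smul_left, h.self_orth]; norm_num

lemma exists_isRealization {𝒟 : Fin 3 → Set ℂ} (h : IsTDT 𝒟) :
    ∃ v u, IsRealization 𝒟 v u := by
  obtain ⟨hshape, htan⟩ := h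
  have hv : ∃ j : Fin 3, ∀ i, ∃ v, lorentz v v = 2 ∧ 0 ≤ v 0 ∧ (i ≠ j → 0 < v 0) ∧
      𝒟 i = region v := by
    rcases hshape with hall | ⟨j, hj, hall⟩
    · refine ⟨0, fun i => ?_⟩
      obtain ⟨v, h1, h2, h3⟩ := exists_region_of_isOpenDisk (hall i)
      exact ⟨v, h1, h2.le, fun _ => h2, h3⟩
    · refine ⟨j, fun i => ?_⟩
      rcases eq_or_ne i j with rfl | hij
      · obtain ⟨v, h1, h2, h3⟩ := exists_region_of_isOpenHalfPlane hj
        exact ⟨v, h1, h2.ge, fun h => absurd rfl h, h3⟩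
      · obtain ⟨v, h1, h2, h3⟩ := exists_region_of_isOpenDisk (hall i hij)
        exact ⟨v, h1, h2.le, fun _ => h2, h3⟩
  obtain ⟨j, hv⟩ := hv
  choose v hself hnonneg hpos hregion using hv
  have ht : ∀ i l, i ≠ l → lorentz (v i) (v l) = -2 := by
    intro i l hil
    obtain ⟨p, hp⟩ := htan i l hil
    rw [hregion, hregion] at hp
    exact lorentz_eq_of_tangent (hself i) (hself l) (hnonneg i) (hnonneg l) hp
  obtain ⟨u, hu⟩ := exists_isFrame hself ht
  have hu0 : u 0 ≠ 0 := by
    have hsq := hu.sq_curv_orth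
    have k0 := hnonneg 0
    have k1 := hnonneg 1
    have k2 := hnonneg 2
    have hσ : 0 < v 1 0 * v 2 0 + v 2 0 * v 0 0 + v 0 0 * v 1 0 := by
      fin_cases j
      · have := hpos 1 (by decide)
        have := hpos 2 (by decide)
        positivity
      · have := hpos 0 (by decide)
        have := hpos 2 (by decide)
        positivity
      · have := hpos 0 (by decide)
        have := hpos 1 (by decide)
        positivity
    intro h0
    rw [← hsq, h0] at hσ
    norm_num at hσ
  rcases lt_or_gt_of_ne hu0 with hneg | hpos'
  · refine ⟨v, _, { hu.neg with nonneg := hnonneg, pos := ?_, eq_region := hregion }⟩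
    simpa using hneg
  · exact ⟨v, u, { hu with nonneg := hnonneg, pos := hpos', eq_region := hregion }⟩

end Descartes

/-- the curvature vector of `𝒟_w` is `(α,β,γ,κ)·M_w`. -/
theorem curvVec_applyWord (𝒟 : Fin 3 → Set ℂ) (h𝒟 : IsTDTplus 𝒟) (w : Word) :
    curvVec (applyWord 𝒟 w) = Matrix.vecMul (curvVec 𝒟) (Mword w) := by
  obtain ⟨v, u, h⟩ := Descartes.exists_isRealization h𝒟.1
  exact h.curvVec_word w
end
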